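/- arXiv:1405.5268 — 4 statements merged into one kernel-verified Lean document; each statement's English description precedes it below -/
import Mathlib

section
/- For every constant C > 0 there exist constants c₁ > 0 and n₀ (depending only on C) such that the following holds for every odd integer n ≥ n₀. Let h : {-1,1}^n → {-1,1} be monotone, odd (h(−x) = −h(x) for all x), invariant under cyclic shifts of the coordinates (h(x₂,…,xₙ,x₁) = h(x₁,…,xₙ)), and have total influence Inf[h] ≤ C·log n. Then there exists a Boolean function f : {-1,1}^n → {-1,1} such that f̂(S) = 0 for every S ⊆ {1,…,n} with |S| ≤ 1, and E_x[f(x)·h(x)] ≥ 1 − c₁·√((log n)/n). -/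
open Finset

noncomputable section

/-- The value `±1` of a bit, with `true ↦ 1` and `false ↦ -1`. -/
def sgn (b : Bool) : ℝ := if b then 1 else -1

/-- Expectation of `f` over a uniformly random point of the hypercube `{-1,1}^ι`. -/
def expect {ι : Type*} [Fintype ι] [DecidableEq ι] (f : (ι → Bool) → ℝ) : ℝ :=
  (∑ x : ι → Bool, f x) / 2 ^ (Fintype.card ι)

/-- Fourier coefficient `ĝ(S) = E[g(x) ∏_{i ∈ S} x_i]`. -/
def fcoef {ι : Type*} [Fintype ι] [DecidableEq ι] (g : (ι → Bool) → ℝ) (S : Finset ι) : ℝ :=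
  expect (fun x => g x * ∏ i ∈ S, sgn (x i))

/-- `g` is `d`-resilient if all its Fourier coefficients of degree at most `d` vanish. -/
def Resilient {ι : Type*} [Fintype ι] [DecidableEq ι] (d : ℕ) (g : (ι → Bool) → ℝ) : Prop :=
  ∀ S : Finset ι, S.card ≤ d → fcoef g S = 0

/-- `f` is Boolean-valued (takes values in `{-1,1}`). -/
def IsBooleanValued {ι : Type*} (f : (ι → Bool) → ℝ) : Prop := ∀ x, f x = 1 ∨ f x = -1

/-- `g` is bounded (takes values in `[-1,1]`). -/
def IsBounded {ι : Type*} (g : (ι → Bool) → ℝ) : Prop := ∀ x, |g x| ≤ 1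

/-- `f` is `α`-approximately `d`-resilient: `f` is `α`-close in `ℓ₁` to a bounded
`d`-resilient function. -/
def ApproxResilient {ι : Type*} [Fintype ι] [DecidableEq ι] (α : ℝ) (d : ℕ)
    (f : (ι → Bool) → ℝ) : Prop :=
  ∃ g : (ι → Bool) → ℝ, Resilient d g ∧ IsBounded g ∧ expect (fun x => |f x - g x|) ≤ α

/-- Total influence `Inf[f] = Σᵢ Pr_x[f(x) ≠ f(x^{⊕i})]`. -/
def totalInfluence {ι : Type*} [Fintype ι] [DecidableEq ι] (f : (ι → Bool) → ℝ) : ℝ :=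
  ∑ i : ι, expect (fun x => if f x = f (Function.update x i (!x i)) then 0 else 1)

/-- The cyclic shift of a point of the hypercube. -/
def rot {n : ℕ} (x : Fin n → Bool) : Fin n → Bool :=
  fun i => x ⟨(i.val + 1) % n, Nat.mod_lt _ i.pos⟩

/-- The antipode `-x` of a point of the hypercube. -/
def antipode {n : ℕ} (x : Fin n → Bool) : Fin n → Bool := fun i => !(x i)

/-- The coordinate sum of a point of the hypercube. -/
def bias {n : ℕ} (x : Fin n → Bool) : ℤ := ∑ i, if x i then 1 else -1

lemma antipode_antipode {n : ℕ} (x : Fin n → Bool) : antipode (antipode x) = x := by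
  funext i; simp [antipode]

lemma antipode_bijective {n : ℕ} : Function.Bijective (antipode : (Fin n → Bool) → _) :=
  Function.Involutive.bijective antipode_antipode

lemma bias_cast {n : ℕ} (x : Fin n → Bool) : (bias x : ℝ) = ∑ i, sgn (x i) := by
  simp [bias, sgn]

lemma bias_antipode {n : ℕ} (x : Fin n → Bool) : bias (antipode x) = -bias x := by
  unfold bias antipode
  rw [← Finset.sum_neg_distrib]
  refine Finset.sum_congr rfl fun i _ => ?_
  cases x i <;> simp

lemma sgn_not (b : Bool) : sgn (!b) = -sgn b := by cases b <;> simp [sgn]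

lemma rot_iterate {n : ℕ} (k : ℕ) (x : Fin n → Bool) (i : Fin n) :
    rot^[k] x i = x ⟨(i.val + k) % n, Nat.mod_lt _ i.pos⟩ := by
  induction k generalizing x i with
  | zero => simp [Nat.mod_eq_of_lt i.isLt]
  | succ k ih =>
    rw [Function.iterate_succ_apply, ih, rot]
    congr 1
    ext
    simp [Nat.add_assoc]

lemma rot_iterate_self {n : ℕ} (x : Fin n → Bool) : rot^[n] x = x := by
  funext i
  rw [rot_iterate]
  simp [Nat.mod_eq_of_lt i.isLt]

lemma rot_injective {n : ℕ} : Function.Injective (rot : (Fin n → Bool) → _) := by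
  intro x y hxy
  cases n with
  | zero => exact Subsingleton.elim _ _
  | succ n =>
    rw [← rot_iterate_self x, ← rot_iterate_self y, Function.iterate_succ_apply,
      Function.iterate_succ_apply, hxy]

lemma rot_apply_add_one {n : ℕ} [NeZero n] (x : Fin n → Bool) (i : Fin n) :
    rot x i = x (i + 1) := by
  unfold rot
  congr 1
  ext
  simp [Fin.val_add]

lemma bias_rot {n : ℕ} (x : Fin n → Bool) : bias (rot x) = bias x := by
  rcases Nat.eq_zero_or_pos n with rfl | hn
  · simp [bias]
  · have : NeZero n := ⟨hn.ne'⟩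
    unfold bias
    simp_rw [rot_apply_add_one]
    exact Equiv.sum_comp (Equiv.addRight (1 : Fin n)) fun i => if x i then (1 : ℤ) else -1

/-- A quantity on `Fin n` that is unchanged by `i ↦ i + 1` is constant. -/
lemma eq_of_succ_invariant {n : ℕ} [NeZero n] (g : Fin n → ℝ) (hg : ∀ i, g (i + 1) = g i)
    (i j : Fin n) : g i = g j := by
  obtain ⟨m, rfl⟩ := Nat.exists_eq_succ_of_ne_zero (NeZero.ne n)
  have key : ∀ i : Fin (m + 1), g i = g 0 := by
    intro i
    induction i using Fin.induction with
    | zero => rfl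
    | succ i ih => rw [← Fin.coeSucc_eq_succ, hg, ih]
  rw [key i, key j]

lemma bias_odd {n : ℕ} (hn : Odd n) (x : Fin n → Bool) : Odd (bias x) := by
  have h2 : bias x = ∑ i : Fin n, (1 + 2 * if x i then (0 : ℤ) else -1) :=
    Finset.sum_congr rfl fun i _ => by split_ifs <;> norm_num
  rw [h2, Finset.sum_add_distrib, ← Finset.mul_sum]
  exact Odd.add_even (by simpa using hn) (even_two_mul _)

lemma bias_le {n : ℕ} (x : Fin n → Bool) : bias x ≤ n := by
  unfold bias
  calc _ ≤ ∑ _i : Fin n, (1 : ℤ) := Finset.sum_le_sum fun i _ => by split_ifs <;> norm_num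
    _ = n := by simp

lemma bias_monotone {n : ℕ} : Monotone (bias : (Fin n → Bool) → ℤ) := by
  intro x y hxy
  refine Finset.sum_le_sum fun i _ => ?_
  have := hxy i
  revert this
  cases x i <;> cases y i <;> simp

/-- Greedy choice of orbits: from a family of orbits of common size `p`, with an invariant weight
bounded by `B`, one can choose orbits whose total weight is within `B` of any target `p * K`. -/
lemma exists_invariant_subset {α : Type*} [DecidableEq α] {r : α → α} {p : ℕ} (hp : 0 < p)
    {s : α → ℕ} (hs : ∀ x, s (r x) = s x) {B : ℕ} (K : ℕ) (W : Finset α)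
    (hW : ∀ x ∈ W, r x ∈ W) (hper : ∀ x ∈ W, Function.minimalPeriod r x = p)
    (hB : ∀ x ∈ W, s x ≤ B) :
    ∃ T ⊆ W, (∀ x ∈ T, r x ∈ T) ∧ ∃ m ≤ K, ∑ x ∈ T, s x = p * m ∧ (T = W ∨ K < m + B) := by
  induction W using Finset.strongInduction with
  | H W ih =>
    rcases W.eq_empty_or_nonempty with rfl | ⟨x, hx⟩
    · exact ⟨∅, by simp, by simp, 0, by simp, by simp, by simp⟩
    have hrx : r^[p] x = x := by
      rw [← hper x hx]; exact Function.iterate_minimalPeriod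
    have hsk : ∀ k, s (r^[k] x) = s x := by
      intro k
      induction k with
      | zero => rfl
      | succ k ih => rw [Function.iterate_succ_apply', hs, ih]
    have hWk : ∀ k, ∀ y ∈ W, r^[k] y ∈ W := by
      intro k
      induction k with
      | zero => simp
      | succ k ih => intro y hy; rw [Function.iterate_succ_apply']; exact hW _ (ih y hy)
    let O : Finset α := (range p).image fun k => r^[k] x
    have hinj : Set.InjOn (fun k => r^[k] x) (range p : Set ℕ) := by
      have := Function.iterate_injOn_Iio_minimalPeriod (f := r) (x := x)
      rw [hper x hx] at this
      intro a ha b hb hab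
      exact this (by simpa using ha) (by simpa using hb) hab
    have hmemO : ∀ k, r^[k] x ∈ O := by
      intro k
      refine Finset.mem_image.2 ⟨k % p, by simpa using Nat.mod_lt _ hp, ?_⟩
      have := Function.iterate_mod_minimalPeriod_eq (f := r) (x := x) (n := k)
      rwa [hper x hx] at this
    have hOW : O ⊆ W := by
      intro y hy
      obtain ⟨k, -, rfl⟩ := Finset.mem_image.1 hy
      exact hWk k x hx
    have hxO : x ∈ O := hmemO 0
    have hsumO : ∑ y ∈ O, s y = p * s x := by
      rw [Finset.sum_image hinj]
      simp [hsk]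
    have hW' : ∀ y ∈ W \ O, r y ∈ W \ O := by
      intro y hy
      rw [Finset.mem_sdiff] at hy ⊢
      refine ⟨hW y hy.1, fun hO => hy.2 ?_⟩
      obtain ⟨k, -, hk⟩ := Finset.mem_image.1 hO
      have hry : r^[p] y = y := by
        rw [← hper y hy.1]; exact Function.iterate_minimalPeriod
      have : y = r^[p - 1 + k] x := by
        rw [Function.iterate_add_apply, hk, ← Function.iterate_succ_apply,
          Nat.succ_eq_add_one, Nat.sub_add_cancel hp, hry]
      rw [this]
      exact hmemO _
    obtain ⟨T, hTW, hT, m, hmK, hsum, hor⟩ := ih (W \ O)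
      (Finset.sdiff_ssubset hOW ⟨x, hxO⟩) hW' (fun y hy => hper y (Finset.mem_sdiff.1 hy).1)
      (fun y hy => hB y (Finset.mem_sdiff.1 hy).1)
    by_cases hlt : K < m + B
    · exact ⟨T, hTW.trans Finset.sdiff_subset, hT, m, hmK, hsum, Or.inr hlt⟩
    · have hTeq : T = W \ O := hor.resolve_right hlt
      refine ⟨W, Finset.Subset.refl _, hW, m + s x, by have := hB x hx; omega, ?_, Or.inl rfl⟩
      rw [← Finset.sum_sdiff hOW, ← hTeq, hsum, hsumO, mul_add]

/-- Few points of the hypercube have a nontrivial rotational symmetry. -/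
lemma card_periodic_le {n : ℕ} (hn : 0 < n) :
    #{x : Fin n → Bool | Function.minimalPeriod rot x ≠ n} ≤ n * 2 ^ (n / 2) := by
  have hdvd : ∀ x : Fin n → Bool, Function.minimalPeriod rot x ∣ n := fun x =>
    Function.IsPeriodicPt.minimalPeriod_dvd (rot_iterate_self x)
  have hlt : ∀ x : Fin n → Bool, Function.minimalPeriod rot x ≠ n →
      Function.minimalPeriod rot x ≤ n / 2 := by
    intro x hx
    obtain ⟨k, hk⟩ := hdvd x
    rw [Nat.le_div_iff_mul_le (by norm_num)]
    have : 2 ≤ k := by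
      by_contra hk2
      have : k = 0 ∨ k = 1 := by omega
      rcases this with rfl | rfl
      · omega
      · exact hx (by omega)
    calc _ ≤ Function.minimalPeriod rot x * k := Nat.mul_le_mul_left _ this
      _ = n := hk.symm
  have hcard : n * 2 ^ (n / 2) = #(range n ×ˢ (univ : Finset (Fin (n / 2) → Bool))) := by
    simp
  rw [hcard]
  refine Finset.card_le_card_of_injOn
    (fun x => (Function.minimalPeriod rot x, fun i => x ⟨i.val, by omega⟩)) ?_ ?_
  · intro x hx
    simp only [coe_filter, mem_univ, true_and, Set.mem_ofPred_eq] at hx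
    have := hlt x hx
    simp
    omega
  · intro x hx y hy hxy
    simp only [coe_filter, mem_univ, true_and, Set.mem_ofPred_eq] at hx hy
    simp only [Prod.mk.injEq] at hxy
    obtain ⟨hd, hres⟩ := hxy
    have hx2 := hlt x hx
    have hdpos : 0 < Function.minimalPeriod rot x :=
      Nat.pos_of_dvd_of_pos (hdvd x) hn
    have hshift : ∀ z : Fin n → Bool, ∀ j (hj : j + Function.minimalPeriod rot z < n),
        z ⟨j + Function.minimalPeriod rot z, hj⟩ = z ⟨j, by omega⟩ := by
      intro z j hj
      have h1 := congrFun (Function.iterate_minimalPeriod (f := rot) (x := z)) ⟨j, by omega⟩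
      rw [rot_iterate] at h1
      rw [← h1]
      congr 1
      ext
      simp [Nat.mod_eq_of_lt hj]
    have key : ∀ j (hj : j < n), x ⟨j, hj⟩ = y ⟨j, hj⟩ := by
      intro j
      induction j using Nat.strong_induction_on with
      | _ j ih =>
        intro hj
        by_cases hjd : j < Function.minimalPeriod rot x
        · exact congrFun hres ⟨j, by omega⟩
        · obtain ⟨k, rfl⟩ := Nat.exists_eq_add_of_le' (not_lt.1 hjd)
          rw [hshift x k hj, ih k (by omega) (by omega)]
          have hj' : k + Function.minimalPeriod rot y < n := by omega
          rw [← hshift y k hj']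
          congr 2
          omega
    funext i
    exact key i.val i.isLt

/-- Negate the first `j` coordinates of a point of the hypercube. -/
def prefixFlip {n : ℕ} (j : ℕ) (x : Fin n → Bool) : Fin n → Bool :=
  fun i => if i.val < j then !(x i) else x i

lemma prefixFlip_zero {n : ℕ} (x : Fin n → Bool) : prefixFlip 0 x = x := by
  funext i; simp [prefixFlip]

lemma prefixFlip_self {n : ℕ} (x : Fin n → Bool) : prefixFlip n x = antipode x := by
  funext i; simp [prefixFlip, antipode]

lemma prefixFlip_prefixFlip {n : ℕ} (j : ℕ) (x : Fin n → Bool) :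
    prefixFlip j (prefixFlip j x) = x := by
  funext i
  by_cases hi : i.val < j <;> simp [prefixFlip, hi]

lemma prefixFlip_antipode {n : ℕ} (j : ℕ) (x : Fin n → Bool) :
    prefixFlip j (antipode x) = antipode (prefixFlip j x) := by
  funext i
  by_cases hi : i.val < j <;> simp [prefixFlip, antipode, hi]

lemma prefixFlip_succ {n : ℕ} (j : ℕ) (hj : j < n) (x : Fin n → Bool) :
    prefixFlip (j + 1) x =
      Function.update (prefixFlip j x) ⟨j, hj⟩ (!(prefixFlip j x ⟨j, hj⟩)) := by
  funext i
  by_cases hi : i = ⟨j, hj⟩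
  · subst hi; simp [prefixFlip]
  · have : i.val ≠ j := fun h => hi (Fin.ext h)
    rw [Function.update_of_ne hi]
    simp only [prefixFlip]
    congr 1
    simp only [eq_iff_iff]
    omega

lemma bias_update_not {n : ℕ} (x : Fin n → Bool) (i : Fin n) :
    bias (Function.update x i (!(x i))) = bias x + if x i then -2 else 2 := by
  unfold bias
  rw [Fintype.sum_eq_add_sum_compl i, Fintype.sum_eq_add_sum_compl i (fun j => if x j then _ else _)]
  have : ∑ j ∈ {i}ᶜ, (if Function.update x i (!(x i)) j then (1 : ℤ) else -1) =
      ∑ j ∈ {i}ᶜ, if x j then (1 : ℤ) else -1 := by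
    refine Finset.sum_congr rfl fun j hj => ?_
    rw [Function.update_of_ne (by simpa using hj)]
  rw [this]
  cases x i <;> simp <;> ring

lemma update_not_le {n : ℕ} (x : Fin n → Bool) (i : Fin n) (hi : x i = true) :
    Function.update x i (!(x i)) ≤ x := by
  rw [update_le_iff]
  exact ⟨by simp [hi], fun _ _ => le_rfl⟩

lemma le_update_not {n : ℕ} (x : Fin n → Bool) (i : Fin n) (hi : x i = false) :
    x ≤ Function.update x i (!(x i)) := by
  rw [le_update_iff]
  exact ⟨by simp [hi], fun _ _ => le_rfl⟩

/-- On a path from a point of positive bias to its antipode, there is a step at which the bias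
drops from `1` to `-1`. -/
lemma exists_prefixFlip_crossing {n : ℕ} (hn : Odd n) (x : Fin n → Bool) (hx : 0 < bias x) :
    ∃ j < n, bias (prefixFlip j x) = 1 ∧ bias (prefixFlip (j + 1) x) = -1 ∧
      prefixFlip (j + 1) x ≤ prefixFlip j x := by
  classical
  have hex : ∃ j, bias (prefixFlip j x) < 0 := ⟨n, by rw [prefixFlip_self, bias_antipode]; omega⟩
  have hle : Nat.find hex ≤ n :=
    Nat.find_min' hex (by rw [prefixFlip_self, bias_antipode]; omega)
  have hspec := Nat.find_spec hex
  have hmin := fun m => Nat.find_min hex (m := m)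
  rcases hfind : Nat.find hex with _ | k
  · rw [hfind, prefixFlip_zero] at hspec
    omega
  · rw [hfind] at hspec hle
    have hk : ¬ bias (prefixFlip k x) < 0 := hmin k (by omega)
    obtain ⟨a, ha⟩ := bias_odd hn (prefixFlip k x)
    have hstep := bias_update_not (prefixFlip k x) ⟨k, by omega⟩
    rw [← prefixFlip_succ] at hstep
    by_cases hb : prefixFlip k x ⟨k, by omega⟩ = true
    · rw [if_pos hb] at hstep
      refine ⟨k, by omega, by omega, by omega, ?_⟩
      rw [prefixFlip_succ k (by omega)]
      exact update_not_le _ _ hb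
    · rw [if_neg hb] at hstep
      omega

/-- The points of bias `1` at which a monotone odd function equals `1` are a fraction at least
`1 / (2 (n + 1))` of the hypercube. -/
lemma card_bias_eq_one_ge {n : ℕ} (hn : Odd n) {h : (Fin n → Bool) → ℝ} (hb : IsBooleanValued h)
    (hm : Monotone h) (ho : ∀ x, h (antipode x) = -h x) :
    2 ^ n ≤ #{x : Fin n → Bool | h x = 1 ∧ bias x = 1} * ((n + 1) * 2) := by
  classical
  set G : Finset (Fin n → Bool) := {x | h x = 1 ∧ bias x = 1} with hG
  have hpos : ∀ x : Fin n → Bool, 0 < bias x →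
      ∃ j < n + 1, prefixFlip j x ∈ G ∨ antipode (prefixFlip j x) ∈ G := by
    intro x hx
    obtain ⟨j, hj, h1, h2, hle⟩ := exists_prefixFlip_crossing hn x hx
    rcases hb (prefixFlip j x) with h3 | h3
    · exact ⟨j, by omega, Or.inl (by simp [hG, h1, h3])⟩
    · refine ⟨j + 1, by omega, Or.inr ?_⟩
      have h4 := hm hle
      have h5 : h (prefixFlip (j + 1) x) = -1 := by
        rcases hb (prefixFlip (j + 1) x) with h6 | h6
        · linarith
        · exact h6
      simp [hG, ho, h5, bias_antipode, h2]
  have hall : ∀ x : Fin n → Bool,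
      ∃ j < n + 1, prefixFlip j x ∈ G ∨ antipode (prefixFlip j x) ∈ G := by
    intro x
    obtain ⟨a, ha⟩ := bias_odd hn x
    rcases lt_or_ge 0 (bias x) with hx | hx
    · exact hpos x hx
    · obtain ⟨j, hj, hor⟩ := hpos (antipode x) (by rw [bias_antipode]; omega)
      rw [prefixFlip_antipode, antipode_antipode] at hor
      exact ⟨j, hj, hor.symm⟩
  have hcover : (univ : Finset (Fin n → Bool)) ⊆
      (G ×ˢ range (n + 1) ×ˢ (univ : Finset Bool)).image
        fun t => prefixFlip t.2.1 (if t.2.2 then antipode t.1 else t.1) := by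
    intro x _
    obtain ⟨j, hj, hor⟩ := hall x
    rw [Finset.mem_image]
    rcases hor with hmem | hmem
    · exact ⟨(prefixFlip j x, j, false), by simp [hmem, hj], by simp [prefixFlip_prefixFlip]⟩
    · exact ⟨(antipode (prefixFlip j x), j, true), by simp [hmem, hj],
        by simp [antipode_antipode, prefixFlip_prefixFlip]⟩
  have h1 := (Finset.card_le_card hcover).trans Finset.card_image_le
  simpa using h1

/-- For monotone functions the influence of a coordinate is its degree-one Fourier coefficient. -/
lemma sum_sensitive_eq {n : ℕ} {h : (Fin n → Bool) → ℝ} (hb : IsBooleanValued h)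
    (hm : Monotone h) (i : Fin n) :
    ∑ x, (if h x = h (Function.update x i (!(x i))) then (0 : ℝ) else 1) =
      ∑ x, h x * sgn (x i) := by
  have hinv : Function.Involutive fun x : Fin n → Bool => Function.update x i (!(x i)) := by
    intro x
    funext j
    by_cases hj : j = i
    · subst hj; simp
    · simp [hj]
  have hneg : ∑ x, h x * sgn (x i) = -∑ x, h (Function.update x i (!(x i))) * sgn (x i) := by
    rw [← Function.Bijective.sum_comp hinv.bijective fun x => h x * sgn (x i),
      ← Finset.sum_neg_distrib]
    refine Finset.sum_congr rfl fun x _ => ?_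
    simp [sgn_not]
  have hpt : ∀ x, 2 * (if h x = h (Function.update x i (!(x i))) then (0 : ℝ) else 1) =
      h x * sgn (x i) - h (Function.update x i (!(x i))) * sgn (x i) := by
    intro x
    rcases Bool.eq_false_or_eq_true (x i) with hi | hi
    · have hle := hm (update_not_le x i hi)
      rcases hb x with h1 | h1 <;> rcases hb (Function.update x i (!(x i))) with h2 | h2 <;>
        first | (exfalso; linarith) | (rw [h1, h2]; norm_num [sgn, hi])
    · have hle := hm (le_update_not x i hi)
      rcases hb x with h1 | h1 <;> rcases hb (Function.update x i (!(x i))) with h2 | h2 <;>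
        first | (exfalso; linarith) | (rw [h1, h2]; norm_num [sgn, hi])
  have hsum := Finset.sum_congr (rfl : (univ : Finset (Fin n → Bool)) = univ) fun x _ => hpt x
  rw [← Finset.mul_sum, Finset.sum_sub_distrib] at hsum
  linarith

/-- The unnormalised degree-one Fourier coefficients of a monotone odd function are nonnegative
multiples of `4`. -/
lemma exists_sum_mul_sgn_eq {n : ℕ} (hn : 2 ≤ n) {h : (Fin n → Bool) → ℝ}
    (hb : IsBooleanValued h) (hm : Monotone h) (ho : ∀ x, h (antipode x) = -h x) (i : Fin n) :
    ∃ K : ℕ, ∑ x, h x * sgn (x i) = 4 * K := by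
  classical
  set E : Finset (Fin n → Bool) := {x | h x ≠ sgn (x i)} with hE
  have hsgn : ∀ b, sgn b = 1 ∨ sgn b = -1 := by intro b; cases b <;> simp [sgn]
  have h1 : ∑ x, h x * sgn (x i) = 2 ^ n - 2 * #E := by
    have : ∀ x, h x * sgn (x i) = 1 - 2 * if h x ≠ sgn (x i) then (1 : ℝ) else 0 := by
      intro x
      rcases hb x with h1 | h1 <;> rcases hsgn (x i) with h2 | h2 <;> rw [h1, h2] <;> norm_num
    rw [Finset.sum_congr rfl fun x _ => this x, Finset.sum_sub_distrib, ← Finset.mul_sum,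
      Finset.sum_boole]
    simp [hE]
  have h2 : #{x ∈ E | ¬ x i = true} = #{x ∈ E | x i = true} := by
    refine Finset.card_bij (fun x _ => antipode x) ?_ ?_ ?_
    · intro x hx
      simp only [hE, Finset.mem_filter, mem_univ, true_and, ho] at hx ⊢
      refine ⟨fun h0 => hx.1 ?_, by simpa [antipode] using hx.2⟩
      simp only [antipode, sgn_not] at h0
      linarith
    · exact fun x _ y _ hxy => antipode_bijective.1 hxy
    · intro x hx
      refine ⟨antipode x, ?_, antipode_antipode x⟩
      simp only [hE, Finset.mem_filter, mem_univ, true_and, ho] at hx ⊢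
      refine ⟨fun h0 => hx.1 ?_, by simpa [antipode] using hx.2⟩
      simp only [antipode, sgn_not] at h0
      linarith
  have h3 := Finset.card_filter_add_card_filter_not (s := E) fun x => x i = true
  rw [h2] at h3
  obtain ⟨m, rfl⟩ := Nat.exists_eq_add_of_le' hn
  have h4 : ∑ x, h x * sgn (x i) = 4 * (2 ^ m - #{x ∈ E | x i = true} : ℝ) := by
    rw [h1, ← h3]; push_cast; ring
  have h5 : 0 ≤ ∑ x, h x * sgn (x i) := by
    rw [← sum_sensitive_eq hb hm]
    exact Finset.sum_nonneg fun x _ => by split_ifs <;> norm_num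
  have h6 : #{x ∈ E | x i = true} ≤ 2 ^ m := by
    have : (#{x ∈ E | x i = true} : ℝ) ≤ (2 ^ m : ℕ) := by push_cast; linarith
    exact_mod_cast this
  exact ⟨2 ^ m - #{x ∈ E | x i = true}, by rw [h4, Nat.cast_sub h6]; push_cast; ring⟩

lemma minimalPeriod_rot {n : ℕ} (x : Fin n → Bool) :
    Function.minimalPeriod rot (rot x) = Function.minimalPeriod rot x := by
  rcases Nat.eq_zero_or_pos n with rfl | hn
  · rw [Subsingleton.elim (rot x) x]
  · exact Function.minimalPeriod_apply (Function.mk_mem_periodicPts hn (rot_iterate_self x))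

/-- If enough points of large bias and enough points of bias `1` are available, there is a small
rotation invariant set of ones of `h` with any prescribed total bias `n * K`. -/
lemma exists_rotInvariant_bias_sum {n : ℕ} (hn : 0 < n) {h : (Fin n → Bool) → ℝ}
    (hr : ∀ x, h (rot x) = h x) {A : ℝ} (hA : 1 < A) {K : ℕ}
    (hbig : (n * K : ℝ) ≤
      A * #{x : Fin n → Bool | h x = 1 ∧ A ≤ bias x ∧ Function.minimalPeriod rot x = n})
    (hone : n ^ 2 ≤
      #{x : Fin n → Bool | h x = 1 ∧ bias x = 1 ∧ Function.minimalPeriod rot x = n}) :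
    ∃ T : Finset (Fin n → Bool), (∀ x ∈ T, h x = 1) ∧ (∀ x ∈ T, rot x ∈ T) ∧
      ∑ x ∈ T, bias x = n * K ∧ (#T : ℝ) ≤ n * K / A + n ^ 2 := by
  classical
  set W₁ : Finset (Fin n → Bool) :=
    {x | h x = 1 ∧ A ≤ bias x ∧ Function.minimalPeriod rot x = n} with hW₁
  set W₂ : Finset (Fin n → Bool) :=
    {x | h x = 1 ∧ bias x = 1 ∧ Function.minimalPeriod rot x = n} with hW₂
  have hA0 : 0 < A := by linarith
  have hs : ∀ x : Fin n → Bool, (bias (rot x)).toNat = (bias x).toNat := fun x => by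
    rw [bias_rot]
  have hpos₁ : ∀ x ∈ W₁, A ≤ ((bias x).toNat : ℝ) := by
    intro x hx
    simp only [hW₁, Finset.mem_filter] at hx
    calc A ≤ ((bias x : ℤ) : ℝ) := hx.2.2.1
      _ ≤ (((bias x).toNat : ℤ) : ℝ) := by exact_mod_cast Int.self_le_toNat _
      _ = ((bias x).toNat : ℝ) := by push_cast; rfl
  obtain ⟨T₁, hT₁W, hT₁, m₁, hm₁, hsum₁, hor₁⟩ := exists_invariant_subset (r := rot) (s := fun x => (bias x).toNat) hn hs
    (B := n) K W₁
    (by intro x hx; simpa [hW₁, bias_rot, hr, minimalPeriod_rot] using hx)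
    (by intro x hx; simp only [hW₁, Finset.mem_filter] at hx; exact hx.2.2.2)
    (by intro x hx; have := bias_le x; omega)
  have hcard₁ : ∀ T ⊆ W₁, A * #T ≤ ((∑ x ∈ T, (bias x).toNat : ℕ) : ℝ) := by
    intro T hT
    rw [mul_comm, ← nsmul_eq_mul]
    push_cast
    exact Finset.card_nsmul_le_sum _ _ _ fun x hx => hpos₁ x (hT hx)
  have hlt₁ : K < m₁ + n := by
    rcases hor₁ with rfl | hlt
    · have h1 := hbig.trans (hcard₁ _ hT₁W)
      rw [hsum₁] at h1
      have h2 : n * K ≤ n * m₁ := by exact_mod_cast h1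
      have := Nat.le_of_mul_le_mul_left h2 hn
      omega
    · exact hlt
  have hbias₂ : ∀ T ⊆ W₂, ∑ x ∈ T, (bias x).toNat = #T := by
    intro T hT
    rw [Finset.card_eq_sum_ones]
    refine Finset.sum_congr rfl fun x hx => ?_
    have := hT hx
    simp only [hW₂, Finset.mem_filter] at this
    simp [this.2.2.1]
  obtain ⟨T₂, hT₂W, hT₂, m₂, hm₂, hsum₂, hor₂⟩ := exists_invariant_subset (r := rot) (s := fun x => (bias x).toNat) hn hs
    (B := 1) (K - m₁)
    W₂ (by intro x hx; simpa [hW₂, bias_rot, hr, minimalPeriod_rot] using hx)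
    (by intro x hx; simp only [hW₂, Finset.mem_filter] at hx; exact hx.2.2.2)
    (by intro x hx; simp only [hW₂, Finset.mem_filter] at hx; simp [hx.2.2.1])
  have hm₂' : m₂ = K - m₁ := by
    rcases hor₂ with rfl | hlt
    · rw [hbias₂ _ hT₂W] at hsum₂
      rw [hsum₂, sq] at hone
      have := Nat.le_of_mul_le_mul_left hone hn
      omega
    · omega
  have hdisj : Disjoint T₁ T₂ := by
    rw [Finset.disjoint_left]
    intro x hx₁ hx₂
    have h1 := hpos₁ x (hT₁W hx₁)
    have h2 := hT₂W hx₂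
    simp only [hW₂, Finset.mem_filter] at h2
    rw [h2.2.2.1] at h1
    norm_num at h1
    linarith
  have htoNat : ∀ x ∈ T₁ ∪ T₂, bias x = ((bias x).toNat : ℤ) := by
    intro x hx
    rw [Int.toNat_of_nonneg]
    rcases Finset.mem_union.1 hx with hx | hx
    · have h1 := hpos₁ x (hT₁W hx)
      by_contra hneg
      rw [Int.toNat_of_nonpos (by omega)] at h1
      norm_num at h1
      linarith
    · have h2 := hT₂W hx
      simp only [hW₂, Finset.mem_filter] at h2
      omega
  refine ⟨T₁ ∪ T₂, ?_, ?_, ?_, ?_⟩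
  · intro x hx
    rcases Finset.mem_union.1 hx with hx | hx
    · have := hT₁W hx; simp only [hW₁, Finset.mem_filter] at this; exact this.2.1
    · have := hT₂W hx; simp only [hW₂, Finset.mem_filter] at this; exact this.2.1
  · intro x hx
    rcases Finset.mem_union.1 hx with hx | hx
    · exact Finset.mem_union_left _ (hT₁ x hx)
    · exact Finset.mem_union_right _ (hT₂ x hx)
  · rw [Finset.sum_congr rfl htoNat, ← Nat.cast_sum, Finset.sum_union hdisj, hsum₁, hsum₂, hm₂',
      ← mul_add, Nat.add_sub_cancel' hm₁]
    push_cast; rfl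
  · rw [Finset.card_union_of_disjoint hdisj]
    push_cast
    refine add_le_add ?_ ?_
    · rw [le_div_iff₀ hA0, mul_comm]
      refine (hcard₁ T₁ hT₁W).trans ?_
      rw [hsum₁]
      exact_mod_cast Nat.mul_le_mul_left n hm₁
    · rw [← hbias₂ T₂ hT₂W, hsum₂, sq]
      exact_mod_cast Nat.mul_le_mul_left n (by omega)

/-- Negating `h` on a rotation invariant set `T` of ones and on its antipode, where `T` has the
right total bias, cancels all Fourier coefficients of degree at most one. -/
lemma exists_boolean_one_resilient {n : ℕ} (hn : 0 < n) {h : (Fin n → Bool) → ℝ}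
    (hb : IsBooleanValued h) (ho : ∀ x, h (antipode x) = -h x) {K : ℕ}
    (hK : ∀ i, ∑ x, h x * sgn (x i) = 4 * K) {T : Finset (Fin n → Bool)}
    (hT : ∀ x ∈ T, h x = 1) (hTr : ∀ x ∈ T, rot x ∈ T) (hTb : ∑ x ∈ T, bias x = n * K) :
    ∃ f : (Fin n → Bool) → ℝ, IsBooleanValued f ∧
      (∀ S : Finset (Fin n), S.card ≤ 1 → fcoef f S = 0) ∧
      _root_.expect (fun x => f x * h x) = 1 - 4 * #T / 2 ^ n := by
  classical
  have : NeZero n := ⟨hn.ne'⟩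
  have hdisj : ∀ x ∈ T, antipode x ∉ T := by
    intro x hx hx'
    have h1 := hT _ hx'
    rw [ho, hT x hx] at h1
    norm_num at h1
  have hcoord : ∀ i, ∑ x ∈ T, sgn (x i) = K := by
    have himg : T.image rot = T :=
      Finset.eq_of_subset_of_card_le (Finset.image_subset_iff.2 hTr)
        (Finset.card_image_of_injective _ rot_injective).ge
    have hstep : ∀ i, ∑ x ∈ T, sgn (x (i + 1)) = ∑ x ∈ T, sgn (x i) := by
      intro i
      conv_rhs => rw [← himg, Finset.sum_image rot_injective.injOn]
      simp_rw [rot_apply_add_one]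
    have hconst := eq_of_succ_invariant (fun i => ∑ x ∈ T, sgn (x i)) hstep
    intro i
    have h1 : ((∑ x ∈ T, bias x : ℤ) : ℝ) = n * ∑ x ∈ T, sgn (x i) := by
      push_cast
      simp_rw [bias_cast]
      rw [Finset.sum_comm, Finset.sum_congr rfl fun j _ => hconst j i]
      simp
    rw [hTb] at h1
    push_cast at h1
    have hn' : (n : ℝ) ≠ 0 := by positivity
    exact (mul_left_cancel₀ hn' h1).symm
  let u : (Fin n → Bool) → ℝ := fun x => if x ∈ T then 1 else 0
  have hu : ∀ x, u x * h x = u x := by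
    intro x
    by_cases hx : x ∈ T
    · simp [u, hx, hT x hx]
    · simp [u, hx]
  let f : (Fin n → Bool) → ℝ := fun x => h x - 2 * u x + 2 * u (antipode x)
  have hf : ∀ x, f x = if x ∈ T ∨ antipode x ∈ T then -h x else h x := by
    intro x
    by_cases hx : x ∈ T
    · simp [f, u, hx, hdisj x hx, hT x hx]; norm_num
    · by_cases hx' : antipode x ∈ T
      · have h1 := hT _ hx'
        rw [ho] at h1
        have h2 : h x = -1 := by linarith
        simp [f, u, hx, hx', h2]; norm_num
      · simp [f, u, hx, hx']
  have hsumanti : ∀ g : (Fin n → Bool) → ℝ, ∑ x, g (antipode x) = ∑ x, g x := fun g =>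
    Function.Bijective.sum_comp antipode_bijective g
  refine ⟨f, ?_, ?_, ?_⟩
  · intro x
    rw [hf]
    split_ifs
    · rcases hb x with h1 | h1 <;> simp [h1]
    · exact hb x
  · intro S hS
    unfold fcoef _root_.expect
    refine div_eq_zero_iff.2 (Or.inl ?_)
    rcases Nat.le_one_iff_eq_zero_or_eq_one.1 hS with h0 | h1
    · rw [Finset.card_eq_zero] at h0
      subst h0
      have hh : ∑ x, h x = 0 := by
        have := hsumanti h
        simp_rw [ho] at this
        rw [Finset.sum_neg_distrib] at this
        linarith
      simp only [prod_empty, mul_one, f, Finset.sum_add_distrib, Finset.sum_sub_distrib, hh,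
        ← Finset.mul_sum, hsumanti u]
      ring
    · obtain ⟨i, rfl⟩ := Finset.card_eq_one.1 h1
      have hu1 : ∑ x, u x * sgn (x i) = K := by
        rw [← hcoord i]
        simp [u, Finset.sum_ite_mem]
      have hu2 : ∑ x, u (antipode x) * sgn (x i) = -K := by
        rw [← hu1, ← hsumanti fun x => u x * sgn (x i), ← Finset.sum_neg_distrib]
        refine Finset.sum_congr rfl fun x _ => ?_
        simp [antipode, sgn_not]
      have : ∀ x, f x * ∏ j ∈ {i}, sgn (x j) =
          h x * sgn (x i) - 2 * (u x * sgn (x i)) + 2 * (u (antipode x) * sgn (x i)) := by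
        intro x; simp only [prod_singleton, f]; ring
      simp_rw [this]
      rw [Finset.sum_add_distrib, Finset.sum_sub_distrib, ← Finset.mul_sum, ← Finset.mul_sum, hK,
        hu1, hu2]
      ring
  · have hpt : ∀ x, f x * h x = 1 - 2 * u x - 2 * u (antipode x) := by
      intro x
      have h1 := hu x
      have h2 := hu (antipode x)
      rw [ho] at h2
      have h3 : h x * h x = 1 := by rcases hb x with h4 | h4 <;> rw [h4] <;> norm_num
      simp only [f]
      linear_combination h3 - 2 * h1 - 2 * h2
    have hus : ∑ x, u x = #T := by simp [u]
    unfold _root_.expect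
    simp_rw [hpt]
    rw [Finset.sum_sub_distrib, Finset.sum_sub_distrib, ← Finset.mul_sum, ← Finset.mul_sum,
      hsumanti u, hus]
    simp
    field_simp
    ring

lemma sum_exp_mul_bias {n : ℕ} (l : ℝ) :
    ∑ x : Fin n → Bool, Real.exp (l * bias x) = 2 ^ n * Real.cosh l ^ n := by
  have h1 : ∀ x : Fin n → Bool, Real.exp (l * bias x) = ∏ i, Real.exp (l * sgn (x i)) := by
    intro x
    rw [bias_cast, Finset.mul_sum, Real.exp_sum]
  simp_rw [h1]
  have h2 := Finset.prod_univ_sum (fun _ : Fin n => (univ : Finset Bool))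
    fun _ b => Real.exp (l * sgn b)
  rw [Fintype.piFinset_univ] at h2
  rw [← h2]
  simp [sgn, Real.cosh_eq, ← mul_pow]
  congr 1
  ring

/-- A second moment bound for `exp (l * bias)` restricted to the ones of `h`, whose first moment is
bounded below by positive correlation of monotone functions. -/
lemma card_exp_bias_ge {n : ℕ} {h : (Fin n → Bool) → ℝ} (hb : IsBooleanValued h)
    (hm : Monotone h) (ho : ∀ x, h (antipode x) = -h x) {l : ℝ} (hl : 0 ≤ l) :
    2 ^ n * (Real.cosh l ^ n) ^ 2 ≤ 16 * Real.cosh (2 * l) ^ n *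
      #{x : Fin n → Bool | h x = 1 ∧ Real.cosh l ^ n / 4 ≤ Real.exp (l * bias x)} := by
  classical
  set μ := Real.cosh l ^ n with hμ
  have hμ0 : 0 < μ := pow_pos (Real.cosh_pos l) n
  set P : Finset (Fin n → Bool) := {x | h x = 1 ∧ μ / 4 ≤ Real.exp (l * bias x)} with hP
  let e : (Fin n → Bool) → ℝ := fun x => Real.exp (l * bias x)
  let u : (Fin n → Bool) → ℝ := fun x => (1 + h x) / 2
  have he : ∑ x, e x = 2 ^ n * μ := sum_exp_mul_bias l
  have hh : ∑ x, h x = 0 := by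
    have := Function.Bijective.sum_comp antipode_bijective h
    simp_rw [ho] at this
    rw [Finset.sum_neg_distrib] at this
    linarith
  have hu : ∑ x, u x = 2 ^ n / 2 := by
    simp only [u]
    rw [← Finset.sum_div, Finset.sum_add_distrib, hh]
    simp
  have hu0 : 0 ≤ u := by
    intro x
    rcases hb x with h1 | h1 <;> simp [u, h1]
  have hfkg := fkg (μ := fun _ : Fin n → Bool => (1 : ℝ)) (f := u) (g := e)
    (fun _ => zero_le_one) hu0 (fun _ => (Real.exp_pos _).le)
    (fun x y hxy => by have := hm hxy; simp only [u]; linarith)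
    (fun x y hxy => by
      have h1 : (bias x : ℝ) ≤ bias y := by exact_mod_cast bias_monotone hxy
      exact Real.exp_le_exp.2 (mul_le_mul_of_nonneg_left h1 hl))
    (fun _ _ => le_rfl)
  simp only [one_mul, he, hu, Finset.sum_const, Finset.card_univ, Fintype.card_pi,
    Fintype.card_bool, Finset.prod_const, Fintype.card_fin, nsmul_eq_mul, mul_one] at hfkg
  push_cast at hfkg
  have h2n : (0 : ℝ) < 2 ^ n := by positivity
  have hue : 2 ^ n * μ / 2 ≤ ∑ x, u x * e x := by
    refine le_of_mul_le_mul_left ?_ h2n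
    linarith
  have hpt : ∀ x, u x * e x ≤ (if x ∈ P then e x else 0) + μ / 4 := by
    intro x
    have he0 : 0 < e x := Real.exp_pos _
    rcases hb x with h1 | h1
    · by_cases hx : μ / 4 ≤ e x
      · have : x ∈ P := by simp only [hP, Finset.mem_filter, mem_univ, true_and]; exact ⟨h1, hx⟩
        rw [if_pos this]
        simp only [u, h1]
        linarith
      · have : x ∉ P := by
          simp only [hP, Finset.mem_filter, mem_univ, true_and]
          exact fun h2 => hx h2.2
        rw [if_neg this]
        simp only [u, h1]
        linarith
    · have : x ∉ P := by
        simp only [hP, Finset.mem_filter, mem_univ, true_and, h1]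
        norm_num
      rw [if_neg this]
      simp only [u, h1]
      linarith
  have hPe : 2 ^ n * μ / 4 ≤ ∑ x ∈ P, e x := by
    have h1 := Finset.sum_le_sum fun x (_ : x ∈ (univ : Finset (Fin n → Bool))) => hpt x
    rw [Finset.sum_add_distrib, Finset.sum_ite_mem, Finset.univ_inter] at h1
    simp only [Finset.sum_const, Finset.card_univ, Fintype.card_pi, Fintype.card_bool,
      Finset.prod_const, Fintype.card_fin, nsmul_eq_mul] at h1
    push_cast at h1
    linarith
  have hcs : (∑ x ∈ P, e x) ^ 2 ≤ #P * (2 ^ n * Real.cosh (2 * l) ^ n) := by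
    refine sq_sum_le_card_mul_sum_sq.trans (mul_le_mul_of_nonneg_left ?_ (Nat.cast_nonneg _))
    rw [← sum_exp_mul_bias]
    calc ∑ x ∈ P, e x ^ 2 ≤ ∑ x, e x ^ 2 :=
          Finset.sum_le_univ_sum_of_nonneg fun x => sq_nonneg _
      _ = ∑ x : Fin n → Bool, Real.exp (2 * l * bias x) := by
          refine Finset.sum_congr rfl fun x _ => ?_
          simp only [e]
          rw [← Real.exp_nat_mul]
          congr 1
          push_cast
          ring
  have hsq : (2 ^ n * μ / 4) ^ 2 ≤ (∑ x ∈ P, e x) ^ 2 :=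
    pow_le_pow_left₀ (by positivity) hPe 2
  refine le_of_mul_le_mul_left ?_ h2n
  linarith [hsq.trans hcs]

lemma sq_div_four_le_log_cosh {l : ℝ} (hl : 0 ≤ l) (hl1 : l ≤ 1) :
    l ^ 2 / 4 ≤ Real.log (Real.cosh l) := by
  have h1 : 1 + l ^ 2 / 2 ≤ Real.cosh l := by
    have h2 : Real.cosh l = 1 + 2 * Real.sinh (l / 2) ^ 2 := by
      have h3 := Real.cosh_two_mul (l / 2)
      rw [Real.cosh_sq, show 2 * (l / 2) = l by ring] at h3
      linarith
    have h4 : l / 2 ≤ Real.sinh (l / 2) := Real.self_le_sinh_iff.2 (by linarith)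
    have h5 : (l / 2) ^ 2 ≤ Real.sinh (l / 2) ^ 2 := pow_le_pow_left₀ (by linarith) h4 2
    nlinarith
  have hpos : 0 < 1 + l ^ 2 / 2 := by positivity
  calc l ^ 2 / 4 ≤ 1 - (1 + l ^ 2 / 2)⁻¹ := by
        rw [le_sub_iff_add_le, ← le_sub_iff_add_le', inv_le_iff_one_le_mul₀ hpos]
        have h6 : l ^ 2 ≤ 1 := pow_le_one₀ hl hl1
        nlinarith [mul_nonneg (sq_nonneg l) (sub_nonneg.2 h6)]
    _ ≤ Real.log (1 + l ^ 2 / 2) := Real.one_sub_inv_le_log_of_pos hpos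
    _ ≤ Real.log (Real.cosh l) := Real.log_le_log hpos h1

/-- A lower bound for the number of points of large bias at which a monotone odd function is `1`. -/
lemma card_large_bias_ge {n : ℕ} {h : (Fin n → Bool) → ℝ} (hb : IsBooleanValued h)
    (hm : Monotone h) (ho : ∀ x, h (antipode x) = -h x) {l : ℝ} (hl : 0 < l) (hl1 : l ≤ 1)
    (hln : Real.log 4 ≤ n * l ^ 2 / 8) :
    2 ^ n * Real.exp (-(2 * n * l ^ 2)) / 16 ≤
      #{x : Fin n → Bool | h x = 1 ∧ n * l / 8 ≤ bias x} := by
  have hsub : #{x : Fin n → Bool | h x = 1 ∧ Real.cosh l ^ n / 4 ≤ Real.exp (l * bias x)} ≤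
      #{x : Fin n → Bool | h x = 1 ∧ n * l / 8 ≤ bias x} := by
    refine Finset.card_le_card fun x hx => ?_
    simp only [Finset.mem_filter, mem_univ, true_and] at hx ⊢
    refine ⟨hx.1, ?_⟩
    have hc := Real.cosh_pos l
    have h1 := Real.log_le_log (by positivity) hx.2
    rw [Real.log_exp, Real.log_div (by positivity) (by norm_num), Real.log_pow] at h1
    have h2 := mul_le_mul_of_nonneg_left (sq_div_four_le_log_cosh hl.le hl1) (Nat.cast_nonneg n)
    refine le_of_mul_le_mul_left ?_ hl
    nlinarith
  have h1 := card_exp_bias_ge hb hm ho hl.le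
  have h2 : (1 : ℝ) ≤ (Real.cosh l ^ n) ^ 2 :=
    one_le_pow₀ (one_le_pow₀ (Real.one_le_cosh l))
  have h3 : Real.cosh (2 * l) ^ n ≤ Real.exp (2 * n * l ^ 2) := by
    calc Real.cosh (2 * l) ^ n ≤ Real.exp ((2 * l) ^ 2 / 2) ^ n :=
          pow_le_pow_left₀ (Real.cosh_pos _).le (Real.cosh_le_exp_half_sq _) n
      _ = Real.exp (2 * n * l ^ 2) := by
          rw [← Real.exp_nat_mul]; congr 1; ring
  set N := ((#{x : Fin n → Bool | h x = 1 ∧ n * l / 8 ≤ bias x} : ℕ) : ℝ) with hN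
  have hN0 : 0 ≤ N := Nat.cast_nonneg _
  have h4 : (2 : ℝ) ^ n ≤ 16 * Real.exp (2 * n * l ^ 2) * N := by
    calc (2 : ℝ) ^ n ≤ 2 ^ n * (Real.cosh l ^ n) ^ 2 := le_mul_of_one_le_right (by positivity) h2
      _ ≤ _ := h1
      _ ≤ 16 * Real.exp (2 * n * l ^ 2) * N := by
          have : 0 < Real.cosh (2 * l) ^ n := pow_pos (Real.cosh_pos _) n
          have hsub' := Nat.cast_le (α := ℝ).2 hsub
          gcongr
  rw [Real.exp_neg, ← div_eq_mul_inv, div_div, div_le_iff₀ (by positivity)]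
  linarith

lemma card_filter_minimalPeriod_ge {n : ℕ} (hn : 0 < n) (p : (Fin n → Bool) → Prop)
    [DecidablePred p] :
    #{x | p x} ≤ #{x | p x ∧ Function.minimalPeriod rot x = n} + n * 2 ^ (n / 2) := by
  classical
  refine le_trans ?_ (Nat.add_le_add_left (card_periodic_le hn) _)
  refine (Finset.card_le_card ?_).trans (Finset.card_union_le _ _)
  intro x hx
  simp only [Finset.mem_filter, mem_univ, true_and, Finset.mem_union] at hx ⊢
  tauto

lemma mul_cube_le_two_pow {n : ℕ} (hn : 50 ≤ n) : 64 * n ^ 3 ≤ 2 ^ (n / 2) := by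
  have key : ∀ m, 25 ≤ m → 1728 * m ^ 3 ≤ 2 ^ m := by
    intro m hm
    induction m, hm using Nat.le_induction with
    | base => norm_num
    | succ m hm ih =>
      rw [pow_succ 2 m]
      have : (m + 1) ^ 3 ≤ 2 * m ^ 3 := by nlinarith [Nat.mul_le_mul hm hm]
      omega
  have h1 := key (n / 2) (by omega)
  have h2 : n ≤ 3 * (n / 2) := by omega
  calc 64 * n ^ 3 ≤ 64 * (3 * (n / 2)) ^ 3 := by gcongr
    _ = 1728 * (n / 2) ^ 3 := by ring
    _ ≤ _ := h1

lemma mul_cube_mul_le_two_pow {n : ℕ} (hn : 50 ≤ n) :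
    64 * n ^ 3 * 2 ^ (n / 2) ≤ 2 ^ n := by
  refine (Nat.mul_le_mul_right _ (mul_cube_le_two_pow hn)).trans ?_
  rw [← pow_add]
  exact Nat.pow_le_pow_right (by norm_num) (by omega)

/-- Most of the points of bias `1` at which `h` is `1` have no rotational symmetry. -/
lemma sq_le_card_bias_eq_one {n : ℕ} (hn : 50 ≤ n) (hodd : Odd n) {h : (Fin n → Bool) → ℝ}
    (hb : IsBooleanValued h) (hm : Monotone h) (ho : ∀ x, h (antipode x) = -h x) :
    n ^ 2 ≤ #{x : Fin n → Bool | h x = 1 ∧ bias x = 1 ∧ Function.minimalPeriod rot x = n} := by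
  have hn0 : 0 < n := by omega
  have hqn := mul_cube_mul_le_two_pow hn
  set q := 2 ^ (n / 2) with hqdef
  have hq1 : 1 ≤ q := Nat.one_le_two_pow
  have h1 := card_bias_eq_one_ge hodd hb hm ho
  have h2 := card_filter_minimalPeriod_ge hn0 fun x => h x = 1 ∧ bias x = 1
  simp only [and_assoc, ← hqdef] at h2
  set M := #{x : Fin n → Bool | h x = 1 ∧ bias x = 1 ∧ Function.minimalPeriod rot x = n}
  by_contra hlt
  have h3 : #{x : Fin n → Bool | h x = 1 ∧ bias x = 1} < n ^ 2 + n * q := by omega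
  have h4 : 2 ^ n < (n ^ 2 + n * q) * ((n + 1) * 2) :=
    h1.trans_lt (Nat.mul_lt_mul_of_pos_right h3 (by omega))
  have h5 : n ^ 2 + n * q ≤ 2 * n * (n * q) := by
    nlinarith [Nat.mul_le_mul hn0 hq1, Nat.mul_le_mul_left (n * n) hq1,
      Nat.mul_le_mul_right (n * q) hn0]
  have h6 : (n ^ 2 + n * q) * ((n + 1) * 2) ≤ 64 * n ^ 3 * q := by
    calc (n ^ 2 + n * q) * ((n + 1) * 2) ≤ (2 * n * (n * q)) * ((n + n) * 2) := by gcongr; omega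
      _ = 8 * n ^ 3 * q := by ring
      _ ≤ 64 * n ^ 3 * q := by gcongr; omega
  omega

/-- The total bias of the points of large bias and without rotational symmetry at which `h` is `1`
dominates any constant multiple of `2 ^ n * log n`. -/
lemma mul_log_le_mul_card_large_bias {n : ℕ} (hn : 50 ≤ n) {h : (Fin n → Bool) → ℝ}
    (hb : IsBooleanValued h) (hm : Monotone h) (ho : ∀ x, h (antipode x) = -h x) {C : ℝ}
    (hC : 0 < C) (hL : 4000 * C + 1000 ≤ Real.log n) {s : ℝ} (hs0 : 0 < s) (hs1 : s ≤ 1)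
    (hns2 : n * s ^ 2 = Real.log n) :
    C * Real.log n * 2 ^ n / 4 ≤ n * s / 32 * #{x : Fin n → Bool |
      h x = 1 ∧ n * s / 32 ≤ bias x ∧ Function.minimalPeriod rot x = n} := by
  have hn0 : 0 < n := by omega
  have hnR : (0 : ℝ) < n := by exact_mod_cast hn0
  have hn1R : (1 : ℝ) ≤ n := by exact_mod_cast hn0
  have hqnR : (64 * n ^ 3 * (2 ^ (n / 2) : ℕ) : ℝ) ≤ 2 ^ n := by
    exact_mod_cast mul_cube_mul_le_two_pow hn
  have hexpL : Real.exp (Real.log n) = n := Real.exp_log hnR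
  set L := Real.log n with hLdef
  set q := 2 ^ (n / 2) with hqdef
  have h1 := card_large_bias_ge hb hm ho (l := s / 4) (by positivity) (by linarith)
    (by
      have h4 : Real.log 4 ≤ 3 := by
        have := Real.log_le_sub_one_of_pos (show (0 : ℝ) < 4 by norm_num); linarith
      have : n * (s / 4) ^ 2 / 8 = L / 128 := by rw [← hns2]; ring
      rw [this]; linarith)
  rw [show 2 * n * (s / 4) ^ 2 = L / 8 by rw [← hns2]; ring,
    show n * (s / 4) / 8 = n * s / 32 by ring] at h1
  have h2 := card_filter_minimalPeriod_ge hn0 fun x => h x = 1 ∧ n * s / 32 ≤ bias x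
  simp only [and_assoc] at h2
  have h3 : ((#{x : Fin n → Bool | h x = 1 ∧ n * s / 32 ≤ bias x} : ℕ) : ℝ) ≤
      #{x : Fin n → Bool | h x = 1 ∧ n * s / 32 ≤ bias x ∧ Function.minimalPeriod rot x = n}
        + n * q := by exact_mod_cast h2
  set M := ((#{x : Fin n → Bool |
    h x = 1 ∧ n * s / 32 ≤ bias x ∧ Function.minimalPeriod rot x = n} : ℕ) : ℝ) with hM
  have h4 : n * q ≤ 2 ^ n * Real.exp (-(L / 8)) / 32 := by
    have h5 : (n : ℝ)⁻¹ ≤ Real.exp (-(L / 8)) := by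
      rw [← hexpL, ← Real.exp_neg]
      exact Real.exp_le_exp.2 (by linarith)
    have h6 : n * q ≤ 2 ^ n * (n : ℝ)⁻¹ / 32 := by
      rw [le_div_iff₀ (by norm_num), ← div_eq_mul_inv, le_div_iff₀ hnR]
      have h7 : (n : ℝ) * q * 32 * n ≤ 64 * n ^ 3 * q := by
        have : (0 : ℝ) ≤ n ^ 2 * q := by positivity
        nlinarith
      linarith
    refine h6.trans ?_
    gcongr
  have h5 : 2 ^ n * Real.exp (-(L / 8)) / 32 ≤ M := by linarith
  have h6 : 8 * C * L ≤ n * s / 32 * Real.exp (-(L / 8)) := by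
    have hsq : Real.exp (L / 2) ≤ n * s := by
      refine le_of_sq_le_sq ?_ (by positivity)
      rw [← Real.exp_nat_mul, show ((2 : ℕ) : ℝ) * (L / 2) = L by push_cast; ring, hexpL,
        show (n * s) ^ 2 = n * (n * s ^ 2) by ring, hns2]
      exact le_mul_of_one_le_right hnR.le (by linarith)
    have h7 : Real.exp (3 * L / 8) ≤ n * s * Real.exp (-(L / 8)) := by
      refine le_trans (le_of_eq ?_) (mul_le_mul_of_nonneg_right hsq (Real.exp_pos _).le)
      rw [← Real.exp_add]; congr 1; ring
    have h8 := Real.quadratic_le_exp_of_nonneg (show 0 ≤ 3 * L / 8 by linarith)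
    nlinarith
  calc C * L * 2 ^ n / 4 = 8 * C * L * (2 ^ n / 32) := by ring
    _ ≤ n * s / 32 * Real.exp (-(L / 8)) * (2 ^ n / 32) := by gcongr
    _ = n * s / 32 * (2 ^ n * Real.exp (-(L / 8)) / 32) := by ring
    _ ≤ n * s / 32 * M := by gcongr

/-- **A Boolean `1`-resilient function close to any monotone, odd, cyclically invariant,
low-influence function.** For every `C > 0` there are `c₁ > 0` and `n₀` such that for every odd
`n ≥ n₀` and every `h : {-1,1}^n → {-1,1}` that is monotone, odd, invariant under cyclic shifts
of the coordinates, and has total influence at most `C·log n`, there is a Boolean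
`f : {-1,1}^n → {-1,1}` with `f̂(S) = 0` for all `|S| ≤ 1` and
`E[f·h] ≥ 1 − c₁·√((log n)/n)`. -/
theorem stmt8 :
    ∀ C : ℝ, 0 < C →
      ∃ c₁ : ℝ, 0 < c₁ ∧ ∃ n₀ : ℕ,
        ∀ n : ℕ, n₀ ≤ n → Odd n →
        ∀ h : (Fin n → Bool) → ℝ, IsBooleanValued h → Monotone h →
          (∀ x : Fin n → Bool, h (fun i => !(x i)) = -h x) →
          (∀ x : Fin n → Bool,
            h (fun i => x ⟨(i.val + 1) % n, Nat.mod_lt _ i.pos⟩) = h x) →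
          totalInfluence h ≤ C * Real.log n →
          ∃ f : (Fin n → Bool) → ℝ, IsBooleanValued f ∧
            (∀ S : Finset (Fin n), S.card ≤ 1 → fcoef f S = 0) ∧
            1 - c₁ * Real.sqrt (Real.log n / n) ≤ expect (fun x => f x * h x) := by
  intro C hC
  obtain ⟨n₀, hn₀⟩ := Filter.eventually_atTop.1
    ((Real.tendsto_log_atTop.comp tendsto_natCast_atTop_atTop).eventually_ge_atTop
      (4000 * C + 1000))
  refine ⟨32 * C + 1, by positivity, n₀ + 50, ?_⟩
  intro n hn hodd h hb hm ho hr hinf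
  replace ho : ∀ x, h (antipode x) = -h x := ho
  replace hr : ∀ x, h (rot x) = h x := hr
  have hn50 : 50 ≤ n := by omega
  have hn0 : 0 < n := by omega
  have : NeZero n := ⟨hn0.ne'⟩
  have hnR : (0 : ℝ) < n := by exact_mod_cast hn0
  have hL : 4000 * C + 1000 ≤ Real.log n := hn₀ n (by omega)
  set L := Real.log n with hLdef
  have hexpL : Real.exp L = n := Real.exp_log hnR
  have hLn : L ≤ n := by rw [← hexpL]; linarith [Real.add_one_le_exp L]
  have hqn : (64 * n ^ 3 : ℝ) ≤ 2 ^ n := by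
    exact_mod_cast (Nat.le_mul_of_pos_right _ (by positivity)).trans
      (mul_cube_mul_le_two_pow hn50)
  have h2n : (0 : ℝ) < 2 ^ n := by positivity
  set s := Real.sqrt (L / n) with hs
  have hs2 : s ^ 2 = L / n := Real.sq_sqrt (by positivity)
  have hns2 : n * s ^ 2 = L := by rw [hs2]; field_simp
  have hs0 : 0 < s := Real.sqrt_pos.2 (by apply div_pos <;> linarith)
  have hs1 : s ≤ 1 := Real.sqrt_le_one.2 ((div_le_one hnR).2 hLn)
  have hA : 1 < n * s / 32 := by
    have h1 : n * s ^ 2 ≤ n * s := by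
      refine mul_le_mul_of_nonneg_left ?_ hnR.le
      nlinarith
    linarith
  obtain ⟨K, hK0⟩ := exists_sum_mul_sgn_eq (by omega : 2 ≤ n) hb hm ho 0
  have hK : ∀ i, ∑ x, h x * sgn (x i) = 4 * K := by
    intro i
    rw [← hK0]
    refine eq_of_succ_invariant (fun i => ∑ x, h x * sgn (x i)) (fun i => ?_) i 0
    rw [← Function.Bijective.sum_comp (Finite.injective_iff_bijective.1 rot_injective)
      fun x => h x * sgn (x i)]
    simp_rw [hr, rot_apply_add_one]
  have hKinf : 4 * (n * K : ℝ) ≤ C * L * 2 ^ n := by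
    have h1 : totalInfluence h = n * (4 * K) / 2 ^ n := by
      unfold totalInfluence _root_.expect
      simp_rw [sum_sensitive_eq hb hm, hK]
      simp
      ring
    rw [h1, div_le_iff₀ h2n] at hinf
    linarith
  obtain ⟨T, hT, hTr, hTb, hTcard⟩ := exists_rotInvariant_bias_sum hn0 hr hA (K := K)
    ((by linarith : (n * K : ℝ) ≤ C * L * 2 ^ n / 4).trans
      (mul_log_le_mul_card_large_bias hn50 hb hm ho hC hL hs0 hs1 hns2))
    (sq_le_card_bias_eq_one hn50 hodd hb hm ho)
  obtain ⟨f, hf, hres, hcor⟩ := exists_boolean_one_resilient hn0 hb ho hK hT hTr hTb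
  refine ⟨f, hf, hres, ?_⟩
  rw [hcor]
  have h1 : 4 * (n * K / (n * s / 32)) ≤ 32 * C * s * 2 ^ n := by
    rw [← mul_div_assoc, div_le_iff₀ (by positivity)]
    calc 4 * (n * K : ℝ) ≤ C * (n * s ^ 2) * 2 ^ n := by rw [hns2]; exact hKinf
      _ = 32 * C * s * 2 ^ n * (n * s / 32) := by ring
  have h2 : 4 * (n : ℝ) ^ 2 ≤ s * 2 ^ n := by
    have h3 : (1 : ℝ) ≤ n * s := by linarith
    have h5 : s * (64 * (n : ℝ) ^ 3) ≤ s * 2 ^ n := mul_le_mul_of_nonneg_left hqn hs0.le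
    nlinarith [pow_pos hnR 2]
  have h3 : 4 * (#T : ℝ) / 2 ^ n ≤ (32 * C + 1) * s := by
    rw [div_le_iff₀ h2n]
    linarith
  linarith
end
end

section
/- Let F : {-1,1}^m → {-1,1}, G : {-1,1}^m → [-1,1], f : {-1,1}^n → {-1,1}, and g : {-1,1}^n → [-1,1], with E[f(x)] = E[g(x)] = 0 (expectations over uniform x on {-1,1}^n). Let δ = dist(f,g). Then dist(F∘f, G∘g) ≤ dist(F,G) + NS_δ[F]. -/
open Finset

noncomputable section

/-- The multilinear (Fourier) extension of `G : {-1,1}^κ → ℝ` to `[-1,1]^κ`, evaluated at `t`: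
`G̃(t) = E[G(b(t₁),…,b(tₘ))]` where `b(tᵢ)` are independent `±1` bits with `E[b(tᵢ)] = tᵢ`. -/
def mExt {κ : Type*} [Fintype κ] [DecidableEq κ] (G : (κ → Bool) → ℝ) (t : κ → ℝ) : ℝ :=
  ∑ y : κ → Bool, G y * ∏ i, (if y i then (1 + t i) / 2 else (1 - t i) / 2)

/-- Disjoint composition `G ∘ g` of `G : {-1,1}^κ → [-1,1]` with `g : {-1,1}^ι → [-1,1]`:
`(G∘g)(x) = G̃(g(x¹),…,g(xᵐ))`, a function on `{-1,1}^{κ × ι}`. -/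
def Comp {κ ι : Type*} [Fintype κ] [DecidableEq κ] [Fintype ι] [DecidableEq ι]
    (G : (κ → Bool) → ℝ) (g : (ι → Bool) → ℝ) : (κ × ι → Bool) → ℝ :=
  fun x => mExt G (fun i => g (fun j => x (i, j)))

/-- `dist(u,v) = (1/2)·E_x[|u(x) − v(x)|]`. -/
def hdist {ι : Type*} [Fintype ι] [DecidableEq ι] (u v : (ι → Bool) → ℝ) : ℝ :=
  expect (fun x => |u x - v x|) / 2

/-- Noise sensitivity `NS_δ[F] = Pr[F(y) ≠ F(z)]` where `y` is uniform and `z` flips each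
coordinate of `y` independently with probability `δ`. -/
def NS {κ : Type*} [Fintype κ] [DecidableEq κ] (δ : ℝ) (F : (κ → Bool) → ℝ) : ℝ :=
  (∑ y : κ → Bool, ∑ z : κ → Bool,
      (∏ i, if z i = y i then 1 - δ else δ) * (if F y = F z then 0 else 1)) /
    2 ^ (Fintype.card κ)

/-- Probability that a `±1` bit of mean `t` equals `b`. -/
def bitWeight (b : Bool) (t : ℝ) : ℝ := if b then (1 + t) / 2 else (1 - t) / 2

theorem bitWeight_nonneg (b : Bool) {t : ℝ} (ht : |t| ≤ 1) : 0 ≤ bitWeight b t := by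
  have := abs_le.1 ht
  cases b <;> simp [bitWeight] <;> linarith

theorem prod_bitWeight_nonneg {κ : Type*} [Fintype κ] (y : κ → Bool) {t : κ → ℝ}
    (ht : ∀ i, |t i| ≤ 1) : 0 ≤ ∏ i, bitWeight (y i) (t i) :=
  prod_nonneg fun i _ => bitWeight_nonneg (y i) (ht i)

theorem sum_prod_bitWeight {κ : Type*} [Fintype κ] [DecidableEq κ] (t : κ → ℝ) :
    ∑ y : κ → Bool, ∏ i, bitWeight (y i) (t i) = 1 := by
  rw [← Fintype.prod_sum fun i b => bitWeight b (t i)]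
  refine prod_eq_one fun i _ => ?_
  simp [bitWeight]
  ring

theorem mExt_eq_sum_bitWeight {κ : Type*} [Fintype κ] [DecidableEq κ] (G : (κ → Bool) → ℝ)
    (t : κ → ℝ) : mExt G t = ∑ y, G y * ∏ i, bitWeight (y i) (t i) := rfl

section Expect

variable {ι : Type*} [Fintype ι] [DecidableEq ι]

theorem cubeExpect_mono {u v : (ι → Bool) → ℝ} (h : ∀ x, u x ≤ v x) : expect u ≤ expect v := by
  unfold _root_.expect
  gcongr with x
  exact h x

theorem cubeExpect_add (u v : (ι → Bool) → ℝ) :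
    expect (fun x => u x + v x) = expect u + expect v := by
  simp only [_root_.expect, sum_add_distrib, add_div]

theorem cubeExpect_const_mul (c : ℝ) (u : (ι → Bool) → ℝ) :
    expect (fun x => c * u x) = c * expect u := by
  simp only [_root_.expect, ← mul_sum, mul_div_assoc]

theorem cubeExpect_const (c : ℝ) : expect (fun _ : ι → Bool => c) = c := by
  simp [_root_.expect]

theorem cubeExpect_sum {α : Type*} (s : Finset α) (u : α → (ι → Bool) → ℝ) :
    expect (fun x => ∑ a ∈ s, u a x) = ∑ a ∈ s, expect (u a) := by
  simp only [_root_.expect, ← sum_div]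
  rw [sum_comm]

/-- Functions of disjoint blocks of coordinates are independent. -/
theorem cubeExpect_prod_blocks {κ : Type*} [Fintype κ] [DecidableEq κ]
    (h : κ → (ι → Bool) → ℝ) :
    expect (fun x : κ × ι → Bool => ∏ i, h i (fun j => x (i, j))) = ∏ i, expect (h i) := by
  simp only [_root_.expect, prod_div_distrib, prod_const, card_univ, Fintype.card_prod]
  rw [Fintype.prod_sum, ← pow_mul, mul_comm (Fintype.card ι)]
  congr 1
  exact Fintype.sum_equiv (Equiv.curry κ ι Bool) _ _ fun x => rfl

theorem cubeExpect_bitWeight {g : (ι → Bool) → ℝ} (hg : expect g = 0) (b : Bool) :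
    expect (fun x => bitWeight b (g x)) = 1 / 2 := by
  have key (c : ℝ) : expect (fun x => 1 / 2 + c * g x) = 1 / 2 := by
    rw [cubeExpect_add, cubeExpect_const, cubeExpect_const_mul, hg]
    ring
  cases b
  · rw [← key (-1 / 2)]
    congr 1; ext x; simp [bitWeight]; ring
  · rw [← key (1 / 2)]
    congr 1; ext x; simp [bitWeight]; ring

theorem hdist_eq_of_isBooleanValued {f g : (ι → Bool) → ℝ} (hf : IsBooleanValued f)
    (hg : IsBounded g) : hdist f g = (1 - expect (fun x => f x * g x)) / 2 := by
  have h : (fun x => |f x - g x|) = fun x => 1 + (-1) * (f x * g x) := by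
    ext x
    have := abs_le.1 (hg x)
    rcases hf x with h | h <;> rw [h]
    · rw [abs_of_nonneg] <;> linarith
    · rw [abs_of_nonpos] <;> linarith
  rw [hdist, h, cubeExpect_add, cubeExpect_const, cubeExpect_const_mul]
  ring

/-- Rounding balanced `f` and `g` at a common uniform point yields a uniform bit together with a
copy flipped with probability `hdist f g`. -/
theorem cubeExpect_bitWeight_mul {f g : (ι → Bool) → ℝ} (hf : IsBooleanValued f)
    (hg : IsBounded g) (hEf : expect f = 0) (hEg : expect g = 0) (b c : Bool) :
    expect (fun x => bitWeight b (f x) * bitWeight c (g x)) =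
      (if c = b then 1 - hdist f g else hdist f g) / 2 := by
  have key (p q r : ℝ) : expect (fun x => 1 / 4 + (p * f x + (q * g x + r * (f x * g x)))) =
      1 / 4 + r * expect (fun x => f x * g x) := by
    rw [cubeExpect_add, cubeExpect_add, cubeExpect_add, cubeExpect_const, cubeExpect_const_mul, cubeExpect_const_mul,
      cubeExpect_const_mul, hEf, hEg]
    ring
  have hfun : (fun x => bitWeight b (f x) * bitWeight c (g x)) = fun x =>
      1 / 4 + (sgn b / 4 * f x + (sgn c / 4 * g x + sgn b * sgn c / 4 * (f x * g x))) := by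
    ext x
    cases b <;> cases c <;> simp [bitWeight, sgn] <;> ring
  rw [hfun, key, hdist_eq_of_isBooleanValued hf hg]
  cases b <;> cases c <;> simp [sgn] <;> ring

end Expect

theorem IsBooleanValued.isBounded {ι : Type*} {f : (ι → Bool) → ℝ} (hf : IsBooleanValued f) :
    IsBounded f := fun x => by
  rcases hf x with h | h <;> simp [h]

section Extension

variable {κ : Type*} [Fintype κ] [DecidableEq κ]

theorem abs_mExt_sub_mExt_le (F G : (κ → Bool) → ℝ) {t : κ → ℝ} (ht : ∀ i, |t i| ≤ 1) :
    |mExt F t - mExt G t| ≤ ∑ y, |F y - G y| * ∏ i, bitWeight (y i) (t i) := by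
  simp only [mExt_eq_sum_bitWeight, ← sum_sub_distrib, ← sub_mul]
  refine (abs_sum_le_sum_abs _ _).trans_eq (sum_congr rfl fun y _ => ?_)
  rw [abs_mul, abs_of_nonneg (prod_bitWeight_nonneg y ht)]

theorem abs_mExt_sub_mExt_le_sum_sum (F : (κ → Bool) → ℝ) {s t : κ → ℝ}
    (hs : ∀ i, |s i| ≤ 1) (ht : ∀ i, |t i| ≤ 1) :
    |mExt F s - mExt F t| ≤
      ∑ y : κ → Bool, ∑ z : κ → Bool, |F y - F z| * ∏ i, (bitWeight (y i) (s i) * bitWeight (z i) (t i)) := by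
  have h1 : mExt F s = ∑ y : κ → Bool, ∑ z : κ → Bool, F y * ∏ i, (bitWeight (y i) (s i) * bitWeight (z i) (t i)) := by
    simp only [mExt_eq_sum_bitWeight, prod_mul_distrib, ← mul_assoc, ← mul_sum,
      sum_prod_bitWeight, mul_one]
  have h2 : mExt F t = ∑ y : κ → Bool, ∑ z : κ → Bool, F z * ∏ i, (bitWeight (y i) (s i) * bitWeight (z i) (t i)) := by
    rw [sum_comm]
    simp only [mExt_eq_sum_bitWeight, prod_mul_distrib, ← mul_sum, ← sum_mul,
      sum_prod_bitWeight, one_mul]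
  rw [h1, h2]
  simp only [← sum_sub_distrib, ← sub_mul]
  refine (abs_sum_le_sum_abs _ _).trans (sum_le_sum fun y _ => ?_)
  refine (abs_sum_le_sum_abs _ _).trans_eq (sum_congr rfl fun z _ => ?_)
  rw [abs_mul, prod_mul_distrib,
    abs_of_nonneg (mul_nonneg (prod_bitWeight_nonneg y hs) (prod_bitWeight_nonneg z ht))]

variable {ι : Type*} [Fintype ι] [DecidableEq ι]

theorem hdist_triangle (u v w : (ι → Bool) → ℝ) : hdist u w ≤ hdist u v + hdist v w := by
  have h := cubeExpect_mono fun x => abs_sub_le (u x) (v x) (w x)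
  rw [cubeExpect_add] at h
  unfold hdist
  linarith

theorem hdist_comp_left_le (F G : (κ → Bool) → ℝ) {g : (ι → Bool) → ℝ} (hg : IsBounded g)
    (hEg : expect g = 0) : hdist (Comp F g) (Comp G g) ≤ hdist F G := by
  have h := cubeExpect_mono fun x : κ × ι → Bool =>
    abs_mExt_sub_mExt_le F G fun i => hg fun j => x (i, j)
  rw [cubeExpect_sum] at h
  unfold hdist
  refine div_le_div_of_nonneg_right (h.trans_eq ?_) zero_le_two
  rw [_root_.expect, sum_div]
  refine sum_congr rfl fun y _ => ?_
  rw [cubeExpect_const_mul, cubeExpect_prod_blocks fun i u => bitWeight (y i) (g u)]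
  simp [cubeExpect_bitWeight hEg, div_eq_mul_inv]

theorem hdist_comp_right_le {F : (κ → Bool) → ℝ} {f g : (ι → Bool) → ℝ}
    (hF : IsBooleanValued F) (hf : IsBooleanValued f) (hg : IsBounded g)
    (hEf : expect f = 0) (hEg : expect g = 0) :
    hdist (Comp F f) (Comp F g) ≤ NS (hdist f g) F := by
  have h := cubeExpect_mono fun x : κ × ι → Bool =>
    abs_mExt_sub_mExt_le_sum_sum F (fun i => hf.isBounded fun j => x (i, j))
      fun i => hg fun j => x (i, j)
  rw [cubeExpect_sum] at h
  refine (div_le_div_of_nonneg_right h zero_le_two).trans_eq ?_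
  rw [NS, sum_div, sum_div]
  refine sum_congr rfl fun y _ => ?_
  rw [cubeExpect_sum, sum_div, sum_div]
  refine sum_congr rfl fun z _ => ?_
  have hFyz : |F y - F z| = 2 * if F y = F z then 0 else 1 := by
    rcases hF y with h1 | h1 <;> rcases hF z with h2 | h2 <;> rw [h1, h2] <;> norm_num
  rw [cubeExpect_const_mul,
    cubeExpect_prod_blocks fun i u => bitWeight (y i) (f u) * bitWeight (z i) (g u), hFyz]
  simp only [cubeExpect_bitWeight_mul hf hg hEf hEg, prod_div_distrib, prod_const, card_univ]
  ring

end Extension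

/-- **Distance bound for disjoint composition.** For `F : {-1,1}^m → {-1,1}`,
`G : {-1,1}^m → [-1,1]`, `f : {-1,1}^n → {-1,1}`, `g : {-1,1}^n → [-1,1]` with
`E[f] = E[g] = 0`, letting `δ = dist(f,g)`:
`dist(F∘f, G∘g) ≤ dist(F,G) + NS_δ[F]`. -/
theorem stmt10 (m n : ℕ) (F G : (Fin m → Bool) → ℝ) (f g : (Fin n → Bool) → ℝ)
    (hF : IsBooleanValued F) (hG : IsBounded G)
    (hf : IsBooleanValued f) (hg : IsBounded g)
    (hEf : expect f = 0) (hEg : expect g = 0) :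
    hdist (Comp F f) (Comp G g) ≤ hdist F G + NS (hdist f g) F := by
  have h₁ := hdist_triangle (Comp F f) (Comp F g) (Comp G g)
  have h₂ := hdist_comp_left_le F G hg hEg
  have h₃ := hdist_comp_right_le hF hf hg hEf hEg
  linarith
end
end

section
/- If G : {-1,1}^m → [-1,1] is d₁-resilient and g : {-1,1}^n → [-1,1] is d₂-resilient, then the disjoint composition G∘g : {-1,1}^{mn} → [-1,1] is (d₁·d₂)-resilient. -/
open Finset

noncomputable section

theorem fcoef_eq_zero_iff {ι : Type*} [Fintype ι] [DecidableEq ι] (g : (ι → Bool) → ℝ)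
    (S : Finset ι) : fcoef g S = 0 ↔ ∑ x, g x * ∏ i ∈ S, sgn (x i) = 0 := by
  simp [fcoef, _root_.expect]

/-- The section of `S ⊆ κ × ι` above `i`. -/
def fiber {κ ι : Type*} [Fintype ι] [DecidableEq κ] [DecidableEq ι] (S : Finset (κ × ι)) (i : κ) :
    Finset ι := univ.filter fun j => (i, j) ∈ S

theorem prod_eq_prod_fiber {κ ι M : Type*} [Fintype κ] [Fintype ι] [DecidableEq κ] [DecidableEq ι]
    [CommMonoid M] (S : Finset (κ × ι)) (f : κ × ι → M) :
    ∏ p ∈ S, f p = ∏ i, ∏ j ∈ fiber S i, f (i, j) := by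
  simp only [fiber, prod_filter]
  rw [← Fintype.prod_prod_type' (fun i j => if (i, j) ∈ S then f (i, j) else 1)]
  simp [Finset.prod_ite_mem]

theorem card_eq_sum_card_fiber {κ ι : Type*} [Fintype κ] [Fintype ι] [DecidableEq κ]
    [DecidableEq ι] (S : Finset (κ × ι)) : S.card = ∑ i, (fiber S i).card := by
  simp only [fiber, card_filter]
  rw [← Fintype.sum_prod_type' (fun i j => if (i, j) ∈ S then 1 else 0)]
  simp

theorem mExt_eq_sum_prod_add {κ : Type*} [Fintype κ] [DecidableEq κ] (G : (κ → Bool) → ℝ)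
    (t : κ → ℝ) : mExt G t = ∑ y, G y * ∏ i, (sgn (y i) * t i + 1) / 2 := by
  refine sum_congr rfl fun y _ => congrArg _ (prod_congr rfl fun i _ => ?_)
  cases y i <;> simp [sgn] <;> ring

/-- Independence of the blocks of a point of the cube `{-1,1}^{κ × ι}`. -/
theorem sum_prod_block {κ ι : Type*} [Fintype κ] [DecidableEq κ] [Fintype ι] [DecidableEq ι]
    (f : κ → (ι → Bool) → ℝ) :
    ∑ x : κ × ι → Bool, ∏ i, f i (fun j => x (i, j)) = ∏ i, ∑ z, f i z := by
  rw [Fintype.prod_sum]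
  exact Fintype.sum_equiv (Equiv.curry κ ι Bool) _ _ fun _ => rfl

/-- The Fourier sum of a disjoint composition, expanded over the characters of `G`. -/
theorem sum_comp_mul_prod {κ ι : Type*} [Fintype κ] [DecidableEq κ] [Fintype ι] [DecidableEq ι]
    (G : (κ → Bool) → ℝ) (g : (ι → Bool) → ℝ) (S : Finset (κ × ι)) :
    ∑ x, Comp G g x * ∏ p ∈ S, sgn (x p) =
      ∑ U : Finset κ, (∑ y, G y * ∏ i ∈ U, sgn (y i)) *
        ((∏ i ∈ U, (∑ z, g z * ∏ j ∈ fiber S i, sgn (z j)) / 2) *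
          ∏ i ∈ univ \ U, (∑ z : ι → Bool, ∏ j ∈ fiber S i, sgn (z j)) / 2) := by
  have block (y : κ → Bool) :
      ∑ x : κ × ι → Bool, (∏ i, (sgn (y i) * g (fun j => x (i, j)) + 1) / 2) *
        ∏ p ∈ S, sgn (x p) =
      ∏ i, (sgn (y i) * ((∑ z, g z * ∏ j ∈ fiber S i, sgn (z j)) / 2) +
        (∑ z : ι → Bool, ∏ j ∈ fiber S i, sgn (z j)) / 2) := by
    simp only [prod_eq_prod_fiber S, ← prod_mul_distrib]
    rw [sum_prod_block fun i z => (sgn (y i) * g z + 1) / 2 * ∏ j ∈ fiber S i, sgn (z j)]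
    refine prod_congr rfl fun i _ => ?_
    rw [sum_div, sum_div, mul_sum, ← sum_add_distrib]
    exact sum_congr rfl fun z _ => by ring
  simp only [Comp, mExt_eq_sum_prod_add, sum_mul]
  rw [sum_comm]
  simp only [mul_assoc, ← mul_sum, block, prod_add, powerset_univ, prod_mul_distrib]
  simp only [mul_sum]
  rw [sum_comm]

theorem Resilient.comp {κ ι : Type*} [Fintype κ] [DecidableEq κ] [Fintype ι] [DecidableEq ι]
    {d₁ d₂ : ℕ} {G : (κ → Bool) → ℝ} {g : (ι → Bool) → ℝ} (hG : Resilient d₁ G)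
    (hg : Resilient d₂ g) : Resilient (d₁ * d₂) (Comp G g) := by
  intro S hS
  rw [fcoef_eq_zero_iff, sum_comp_mul_prod]
  refine sum_eq_zero fun U _ => ?_
  by_cases hU : U.card ≤ d₁
  · rw [(fcoef_eq_zero_iff G U).1 (hG U hU), zero_mul]
  · obtain ⟨i, hi, hcard⟩ : ∃ i ∈ U, (fiber S i).card ≤ d₂ := by
      by_contra! h
      have h₁ : U.card * (d₂ + 1) ≤ ∑ i ∈ U, (fiber S i).card := by
        simpa using card_nsmul_le_sum U (fun i => (fiber S i).card) (d₂ + 1) h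
      have h₂ : ∑ i ∈ U, (fiber S i).card ≤ S.card := by
        rw [card_eq_sum_card_fiber S]
        exact sum_le_sum_of_subset (subset_univ U)
      nlinarith
    have hz : (∑ z, g z * ∏ j ∈ fiber S i, sgn (z j)) / 2 = 0 := by
      rw [(fcoef_eq_zero_iff g _).1 (hg _ hcard), zero_div]
    rw [prod_eq_zero hi hz, zero_mul, mul_zero]

/-- **Resilience of disjoint composition.** If `G : {-1,1}^m → [-1,1]` is `d₁`-resilient and
`g : {-1,1}^n → [-1,1]` is `d₂`-resilient, then `G∘g : {-1,1}^{mn} → [-1,1]` is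
`(d₁·d₂)`-resilient. -/
theorem stmt11 (m n d₁ d₂ : ℕ) (G : (Fin m → Bool) → ℝ) (g : (Fin n → Bool) → ℝ)
    (hG : IsBounded G) (hg : IsBounded g)
    (hGr : Resilient d₁ G) (hgr : Resilient d₂ g) :
    Resilient (d₁ * d₂) (Comp G g) := by
  exact hGr.comp hgr
end
end

section
/- There exists a universal constant c > 0 such that for every ε > 0 there exist arbitrarily large integers N for which there is a monotone Boolean function F : {-1,1}^N → {-1,1} that is ε-approximately d-resilient with d ≥ 2^{c·√(log N)}. -/
open Finset

noncomputable section

open scoped BigOperators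

lemma expect_pi_prod {ι κ : Type*} [Fintype ι] [DecidableEq ι] [Fintype κ] (f : ι → κ → ℝ) :
    𝔼 p : ι → κ, ∏ i, f i (p i) = ∏ i, 𝔼 j, f i j := by
  simp only [Fintype.expect_eq_sum_div_card, Finset.prod_div_distrib, Finset.prod_univ_sum,
    Fintype.piFinset_univ, Fintype.card_fun, Finset.prod_const, Finset.card_univ, Nat.cast_pow]

lemma expect_cube_eq {ι : Type*} [Fintype ι] [DecidableEq ι] (f : (ι → Bool) → ℝ) :
    _root_.expect f = 𝔼 x, f x := by
  simp [_root_.expect, Fintype.expect_eq_sum_div_card]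

lemma abs_prod_sgn {ι : Type*} (S : Finset ι) (x : ι → Bool) : |∏ i ∈ S, sgn (x i)| = 1 := by
  rw [Finset.abs_prod]
  refine Finset.prod_eq_one fun i _ => ?_
  cases x i <;> simp [sgn]

lemma fcoef_prod_sgn {ι : Type*} [Fintype ι] [DecidableEq ι] (S T : Finset ι) :
    fcoef (fun x => ∏ i ∈ S, sgn (x i)) T = if S = T then 1 else 0 := by
  have h : ∀ x : ι → Bool, (∏ i ∈ S, sgn (x i)) * ∏ i ∈ T, sgn (x i) =
      ∏ i, (if i ∈ S then sgn (x i) else 1) * (if i ∈ T then sgn (x i) else 1) := by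
    intro x
    rw [Finset.prod_mul_distrib, Finset.prod_ite_mem, Finset.prod_ite_mem,
      Finset.univ_inter, Finset.univ_inter]
  rw [fcoef, expect_cube_eq]
  simp only [h]
  rw [expect_pi_prod
    (fun i b => (if i ∈ S then sgn b else 1) * (if i ∈ T then sgn b else 1))]
  have h2 : ∀ i, (𝔼 b : Bool, (if i ∈ S then sgn b else 1) * (if i ∈ T then sgn b else 1)) =
      if (i ∈ S ↔ i ∈ T) then (1 : ℝ) else 0 := by
    intro i
    rw [Fintype.expect_eq_sum_div_card]
    by_cases h1 : i ∈ S <;> by_cases h2 : i ∈ T <;> norm_num [h1, h2, sgn]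
  simp only [h2]
  rw [Finset.prod_ite_zero]
  simp [Finset.ext_iff]

lemma fcoef_sub {ι : Type*} [Fintype ι] [DecidableEq ι] (f g : (ι → Bool) → ℝ) (S : Finset ι) :
    fcoef (fun x => f x - g x) S = fcoef f S - fcoef g S := by
  simp only [fcoef, expect_cube_eq, sub_mul, Finset.expect_sub_distrib]

lemma fcoef_div {ι : Type*} [Fintype ι] [DecidableEq ι] (f : (ι → Bool) → ℝ) (c : ℝ)
    (S : Finset ι) : fcoef (fun x => f x / c) S = fcoef f S / c := by
  simp only [fcoef, expect_cube_eq, Finset.expect_div, div_mul_eq_mul_div]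

lemma fcoef_sum_mul {ι : Type*} [Fintype ι] [DecidableEq ι] {κ : Type*} (s : Finset κ)
    (c : κ → ℝ) (f : κ → (ι → Bool) → ℝ) (S : Finset ι) :
    fcoef (fun x => ∑ k ∈ s, c k * f k x) S = ∑ k ∈ s, c k * fcoef (f k) S := by
  simp only [fcoef, expect_cube_eq, Finset.sum_mul, Finset.expect_sum_comm, Finset.mul_expect,
    mul_assoc]

/-- Removing the low-degree part of a bounded function with small low-degree Fourier weight and
renormalising gives a nearby bounded resilient function. -/
lemma approxResilient_of_sum_fcoef_sq_le {ι : Type*} [Fintype ι] [DecidableEq ι]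
    {d K : ℕ} {f g : (ι → Bool) → ℝ} {a δ : ℝ} (hg : IsBounded g)
    (hfg : 𝔼 x, |f x - g x| ≤ a) (hδ : 0 ≤ δ)
    (hK : #{S : Finset ι | #S ≤ d} ≤ K)
    (hW : K * ∑ S : Finset ι with #S ≤ d, fcoef g S ^ 2 ≤ δ ^ 2) :
    ApproxResilient (a + 2 * δ) d f := by
  set u : (ι → Bool) → ℝ := fun x =>
    ∑ S : Finset ι with #S ≤ d, fcoef g S * ∏ i ∈ S, sgn (x i) with hu
  have hub : ∀ x, |u x| ≤ δ := by
    intro x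
    have h1 : |u x| ≤ ∑ S : Finset ι with #S ≤ d, |fcoef g S| := by
      refine (Finset.abs_sum_le_sum_abs _ _).trans (le_of_eq ?_)
      refine Finset.sum_congr rfl fun S _ => ?_
      rw [abs_mul, abs_prod_sgn, mul_one]
    refine h1.trans (abs_le_of_sq_le_sq' ?_ hδ).2
    refine (sq_sum_le_card_mul_sum_sq).trans (le_trans ?_ hW)
    simp only [sq_abs]
    gcongr
  have h0 : (0 : ℝ) < 1 + δ := by linarith
  refine ⟨fun x => (g x - u x) / (1 + δ), ?_, ?_, ?_⟩
  · intro S hS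
    rw [fcoef_div, fcoef_sub, hu, fcoef_sum_mul]
    simp [fcoef_prod_sgn, hS]
  · intro x
    have h1 := hg x
    have h2 := hub x
    rw [abs_div, abs_of_pos h0, div_le_one h0]
    exact (abs_sub _ _).trans (by linarith)
  · rw [expect_cube_eq]
    have h1 : ∀ x, |f x - (g x - u x) / (1 + δ)| ≤ |f x - g x| + 2 * δ := by
      intro x
      have h3 : |g x - (g x - u x) / (1 + δ)| ≤ 2 * δ := by
        have h4 : g x - (g x - u x) / (1 + δ) = (δ * g x + u x) / (1 + δ) := by
          field_simp; ring
        rw [h4, abs_div, abs_of_pos h0, div_le_iff₀ h0]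
        have h5 := hub x
        have h6 : |δ * g x| ≤ δ := by
          rw [abs_mul, abs_of_nonneg hδ]
          exact mul_le_of_le_one_right hδ (hg x)
        have := abs_add_le (δ * g x) (u x)
        nlinarith [mul_nonneg hδ hδ]
      have := abs_sub_le (f x) (g x) ((g x - u x) / (1 + δ))
      linarith
    calc _ ≤ 𝔼 x, (|f x - g x| + 2 * δ) := Finset.expect_le_expect fun x _ => h1 x
      _ = (𝔼 x, |f x - g x|) + 2 * δ := by
          rw [Finset.expect_add_distrib, Finset.expect_const Finset.univ_nonempty]
      _ ≤ _ := by linarith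

/-- Averaged over a random `0/1`-valued function `I t`, small covariances and small bias yield an
outcome for which `1 - 2 * I t` is approximately resilient. -/
lemma exists_approxResilient_of_covariance {ι Ω : Type*} [Fintype ι] [DecidableEq ι] [Fintype Ω]
    [Nonempty Ω] (d K : ℕ) (I : Ω → (ι → Bool) → ℝ) (hI : ∀ t x, I t x = 0 ∨ I t x = 1)
    (q : (ι → Bool) → ℝ) (hq : ∀ x, 𝔼 t, I t x = q x) {η κ δ : ℝ}
    (hη : 𝔼 x, |1 - 2 * q x| ≤ η)
    (hκ : 𝔼 x, 𝔼 y, |(𝔼 t, I t x * I t y) - q x * q y| ≤ κ)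
    (hK : #{S : Finset ι | #S ≤ d} ≤ K) (hδ : 0 ≤ δ) (hKκ : 4 * K ^ 2 * κ ≤ δ ^ 2) :
    ∃ t, ApproxResilient (2 * η + 2 * δ) d (fun x => 1 - 2 * I t x) := by
  have hq0 : ∀ x, 0 ≤ q x := fun x => by
    rw [← hq]; exact Finset.expect_nonneg fun t _ => by rcases hI t x with h | h <;> simp [h]
  have hq1 : ∀ x, q x ≤ 1 := fun x => by
    rw [← hq]
    exact Finset.expect_le Finset.univ_nonempty fun t _ => by rcases hI t x with h | h <;> simp [h]
  set M : (ι → Bool) → ℝ := fun x => max (q x) (1 - q x) with hM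
  have hM1 : ∀ x, q x ≤ M x := fun x => le_max_left _ _
  have hM2 : ∀ x, 1 - q x ≤ M x := fun x => le_max_right _ _
  have hMh : ∀ x, 1 / 2 ≤ M x := fun x => by linarith [hM1 x, hM2 x]
  have hMpos : ∀ x, 0 < M x := fun x => by linarith [hMh x]
  set g : Ω → (ι → Bool) → ℝ := fun t x => (q x - I t x) / M x with hgdef
  have hgb : ∀ t, IsBounded (g t) := by
    intro t x
    rw [hgdef]
    simp only
    rw [abs_div, abs_of_pos (hMpos x), div_le_one (hMpos x), abs_le]
    have := hM1 x; have := hM2 x; have := hq0 x; have := hq1 x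
    rcases hI t x with h | h <;> rw [h] <;> constructor <;> linarith
  have hfg : ∀ t, 𝔼 x, |(1 - 2 * I t x) - g t x| ≤ 2 * η := by
    intro t
    refine le_trans ?_ (mul_le_mul_of_nonneg_left hη zero_le_two)
    rw [Finset.mul_expect]
    refine Finset.expect_le_expect fun x _ => ?_
    have e : (1 - 2 * I t x) - g t x = ((1 - 2 * I t x) * M x - (q x - I t x)) / M x := by
      rw [hgdef]
      field_simp [(hMpos x).ne']
    rw [e, abs_div, abs_of_pos (hMpos x), div_le_iff₀ (hMpos x)]
    have h1 : |(1 - 2 * I t x) * M x - (q x - I t x)| ≤ |1 - 2 * q x| := by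
      rcases max_choice (q x) (1 - q x) with h | h <;> rcases hI t x with h' | h' <;>
      · simp only [hM, h, h']
        rw [abs_le]
        constructor <;> linarith [neg_abs_le (1 - 2 * q x), le_abs_self (1 - 2 * q x),
          abs_nonneg (1 - 2 * q x)]
    nlinarith [hMh x, abs_nonneg (1 - 2 * q x)]
  have hcov : ∀ x y, |𝔼 t, g t x * g t y| ≤ 4 * |(𝔼 t, I t x * I t y) - q x * q y| := by
    intro x y
    have e : (𝔼 t, g t x * g t y) = ((𝔼 t, I t x * I t y) - q x * q y) / (M x * M y) := by
      have h1 : ∀ t, g t x * g t y =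
          (q x * q y - q x * I t y - I t x * q y + I t x * I t y) / (M x * M y) := by
        intro t
        rw [hgdef]
        simp only
        rw [div_mul_div_comm]
        ring
      simp only [h1]
      rw [← Finset.expect_div, Finset.expect_add_distrib, Finset.expect_sub_distrib,
        Finset.expect_sub_distrib, Finset.expect_const Finset.univ_nonempty,
        ← Finset.mul_expect, ← Finset.expect_mul, hq, hq]
      ring
    have h2 : 1 / 4 ≤ M x * M y := by nlinarith [hMh x, hMh y]
    rw [e, abs_div, abs_of_pos (mul_pos (hMpos x) (hMpos y)), div_le_iff₀ (by linarith)]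
    nlinarith [abs_nonneg ((𝔼 t, I t x * I t y) - q x * q y)]
  have hS : ∀ S : Finset ι, 𝔼 t, fcoef (g t) S ^ 2 ≤ 4 * κ := by
    intro S
    have e : (𝔼 t, fcoef (g t) S ^ 2) = 𝔼 x : ι → Bool, 𝔼 y : ι → Bool,
        ((∏ i ∈ S, sgn (x i)) * ∏ i ∈ S, sgn (y i)) * 𝔼 t, g t x * g t y := by
      simp only [fcoef, expect_cube_eq, sq, Finset.expect_mul_expect]
      simp only [Finset.mul_expect]
      rw [Finset.expect_comm]
      refine Finset.expect_congr rfl fun x _ => ?_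
      rw [Finset.expect_comm]
      refine Finset.expect_congr rfl fun y _ => Finset.expect_congr rfl fun t _ => ?_
      ring
    rw [e]
    refine le_trans ?_ (mul_le_mul_of_nonneg_left hκ zero_le_four)
    rw [Finset.mul_expect]
    refine Finset.expect_le_expect fun x _ => ?_
    rw [Finset.mul_expect]
    refine Finset.expect_le_expect fun y _ => ?_
    refine (le_abs_self _).trans ?_
    rw [abs_mul, abs_mul, abs_prod_sgn, abs_prod_sgn, one_mul, one_mul]
    exact hcov x y
  have hκ0 : 0 ≤ κ := le_trans
    (Finset.expect_nonneg fun x _ => Finset.expect_nonneg fun y _ => abs_nonneg _) hκ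
  have hW : 𝔼 t, ∑ S : Finset ι with #S ≤ d, fcoef (g t) S ^ 2 ≤ K * (4 * κ) := by
    rw [Finset.expect_sum_comm]
    refine (Finset.sum_le_card_nsmul _ _ _ fun S _ => hS S).trans ?_
    rw [nsmul_eq_mul]
    gcongr
  obtain ⟨t, -, ht⟩ := Finset.exists_le_of_expect_le Finset.univ_nonempty hW
  refine ⟨t, approxResilient_of_sum_fcoef_sq_le (hgb t) (hfg t) hδ hK (le_trans ?_ hKκ)⟩
  calc _ ≤ (K : ℝ) * (K * (4 * κ)) := by gcongr
    _ = _ := by ring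

/-- The `0/1` value of a bit. -/
def bitVal (b : Bool) : ℝ := if b then 1 else 0

/-- The `0/1` indicator that the term selecting variable `τ i` in every block `i` is satisfied. -/
def termSat {A B : Type*} [Fintype A] (τ : A → B) (x : A → B → Bool) : ℝ :=
  ∏ i, bitVal (x i (τ i))

/-- The `0/1` indicator that no term of the DNF with terms `T j` is satisfied. -/
def dnfUnsat {A B J : Type*} [Fintype A] [Fintype J] (T : J → A → B) (x : A → B → Bool) : ℝ :=
  ∏ j, (1 - termSat (T j) x)

lemma bitVal_nonneg (b : Bool) : 0 ≤ bitVal b := by cases b <;> simp [bitVal]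

lemma bitVal_mono : Monotone bitVal := by
  intro a b h
  cases a <;> cases b
  · exact le_rfl
  · simp [bitVal]
  · exact absurd h (by decide)
  · exact le_rfl

lemma termSat_eq_zero_or_one {A B : Type*} [Fintype A] (τ : A → B) (x : A → B → Bool) :
    termSat τ x = 0 ∨ termSat τ x = 1 := by
  by_cases h : ∀ i, x i (τ i) = true
  · right; simp [termSat, bitVal, h]
  · left
    push Not at h
    obtain ⟨i, hi⟩ := h
    exact Finset.prod_eq_zero (Finset.mem_univ i) (by simp [bitVal, hi])

lemma termSat_nonneg {A B : Type*} [Fintype A] (τ : A → B) (x : A → B → Bool) :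
    0 ≤ termSat τ x := by rcases termSat_eq_zero_or_one τ x with h | h <;> simp [h]

lemma termSat_le_one {A B : Type*} [Fintype A] (τ : A → B) (x : A → B → Bool) :
    termSat τ x ≤ 1 := by rcases termSat_eq_zero_or_one τ x with h | h <;> simp [h]

lemma termSat_mono {A B : Type*} [Fintype A] (τ : A → B) : Monotone (termSat τ) := fun _ _ h =>
  Finset.prod_le_prod (fun _ _ => bitVal_nonneg _) fun i _ => bitVal_mono (h i (τ i))

lemma dnfUnsat_eq_zero_or_one {A B J : Type*} [Fintype A] [Fintype J] (T : J → A → B)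
    (x : A → B → Bool) : dnfUnsat T x = 0 ∨ dnfUnsat T x = 1 := by
  by_cases h : ∀ j, termSat (T j) x = 0
  · right; simp [dnfUnsat, h]
  · left
    push Not at h
    obtain ⟨j, hj⟩ := h
    have := (termSat_eq_zero_or_one (T j) x).resolve_left hj
    exact Finset.prod_eq_zero (Finset.mem_univ j) (by simp [this])

lemma dnfUnsat_antitone {A B J : Type*} [Fintype A] [Fintype J] (T : J → A → B) :
    Antitone (dnfUnsat T) := fun _ _ h =>
  Finset.prod_le_prod (fun _ _ => sub_nonneg.2 (termSat_le_one _ _))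
    fun j _ => sub_le_sub_left (termSat_mono (T j) h) 1

lemma expect_bitVal_mul_bitVal {B : Type*} [Fintype B] [DecidableEq B] (b c : B) :
    𝔼 z : B → Bool, bitVal (z b) * bitVal (z c) = 1 / 4 + if b = c then 1 / 4 else 0 := by
  have h : ∀ z : B → Bool, bitVal (z b) * bitVal (z c) =
      ∏ k, (if k = b then bitVal (z k) else 1) * (if k = c then bitVal (z k) else 1) := by
    intro z
    rw [Finset.prod_mul_distrib, Finset.prod_ite_eq', Finset.prod_ite_eq']
    simp
  simp only [h]
  rw [expect_pi_prod
    (fun k v => (if k = b then bitVal v else 1) * (if k = c then bitVal v else 1))]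
  have h2 : ∀ k : B, (𝔼 v : Bool, (if k = b then bitVal v else 1) *
      (if k = c then bitVal v else 1)) =
      (if k = b then 1 / 2 else 1) * (if k = c then if b = c then 1 else 1 / 2 else 1) := by
    intro k
    rw [Fintype.expect_eq_sum_div_card]
    by_cases h1 : k = b <;> by_cases h2 : k = c
    · subst h1; subst h2; norm_num [bitVal]
    · subst h1; norm_num [bitVal, h2]
    · subst h2; norm_num [bitVal, h1, Ne.symm h1]
    · norm_num [h1, h2]
  simp only [h2]
  rw [Finset.prod_mul_distrib, Finset.prod_ite_eq', Finset.prod_ite_eq']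
  by_cases hbc : b = c <;> norm_num [hbc]

lemma bitVal_mul_self (b : Bool) : bitVal b * bitVal b = bitVal b := by
  cases b <;> simp [bitVal]

lemma expect_bitVal {B : Type*} [Fintype B] [DecidableEq B] (b : B) :
    𝔼 z : B → Bool, bitVal (z b) = 1 / 2 := by
  have := expect_bitVal_mul_bitVal b b
  simp only [bitVal_mul_self, if_true] at this
  rw [this]; norm_num

lemma abs_pow_sub_pow_le_of_mem_Icc {a b : ℝ} (ha : 0 ≤ a) (ha1 : a ≤ 1) (hb : 0 ≤ b)
    (hb1 : b ≤ 1) (n : ℕ) : |a ^ n - b ^ n| ≤ n * |a - b| := by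
  refine (abs_pow_sub_pow_le a b n).trans ?_
  have : max |a| |b| ^ (n - 1) ≤ 1 := by
    rw [abs_of_nonneg ha, abs_of_nonneg hb]
    exact pow_le_one₀ (le_max_of_le_left ha) (max_le ha1 hb1)
  calc |a - b| * n * max |a| |b| ^ (n - 1) ≤ |a - b| * n * 1 := by gcongr
    _ = _ := by ring

lemma expect_abs_le_sqrt {X : Type*} [Fintype X] [Nonempty X] (f : X → ℝ) :
    𝔼 x, |f x| ≤ √(𝔼 x, f x ^ 2) := by
  refine Real.le_sqrt_of_sq_le ?_
  rw [Fintype.expect_eq_sum_div_card, Fintype.expect_eq_sum_div_card, div_pow]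
  have h := sq_sum_le_card_mul_sum_sq (s := (Finset.univ : Finset X)) (f := fun x => |f x|)
  have hc : (0 : ℝ) < Fintype.card X := by exact_mod_cast Fintype.card_pos
  rw [div_le_div_iff₀ (by positivity) hc]
  simp only [sq_abs, Finset.card_univ] at h
  nlinarith

/-- The probability that a random term is satisfied by `x`. -/
def satProb {A B : Type*} [Fintype A] [DecidableEq A] [Fintype B] 
    (x : A → B → Bool) : ℝ := 𝔼 τ : A → B, termSat τ x

lemma satProb_nonneg {A B : Type*} [Fintype A] [DecidableEq A] [Fintype B] 
    (x : A → B → Bool) : 0 ≤ satProb x :=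
  Finset.expect_nonneg fun τ _ => termSat_nonneg τ x

lemma satProb_le_one {A B : Type*} [Fintype A] [DecidableEq A] [Fintype B] 
    [Nonempty B] (x : A → B → Bool) : satProb x ≤ 1 :=
  Finset.expect_le Finset.univ_nonempty fun τ _ => termSat_le_one τ x

lemma expect_dnfUnsat {A B : Type*} [Fintype A] [DecidableEq A] [Fintype B] [Nonempty B]
    {J : Type*} [Fintype J] [DecidableEq J] (x : A → B → Bool) :
    𝔼 T : J → A → B, dnfUnsat T x = (1 - satProb x) ^ Fintype.card J := by
  simp only [dnfUnsat]
  rw [expect_pi_prod (fun _ τ => 1 - termSat τ x), Finset.prod_const, Finset.card_univ,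
    Finset.expect_sub_distrib, Fintype.expect_const, satProb]

lemma abs_covariance_dnfUnsat_le {A B J : Type*} [Fintype A] [DecidableEq A] [Fintype B]
    [Nonempty B] [Fintype J] [DecidableEq J] (x y : A → B → Bool) :
    |(𝔼 T : J → A → B, dnfUnsat T x * dnfUnsat T y) -
      (1 - satProb x) ^ Fintype.card J * (1 - satProb y) ^ Fintype.card J| ≤
      Fintype.card J * ((𝔼 τ : A → B, termSat τ x * termSat τ y) + satProb x * satProb y) := by
  have h1 : (𝔼 T : J → A → B, dnfUnsat T x * dnfUnsat T y) =
      (𝔼 τ : A → B, (1 - termSat τ x) * (1 - termSat τ y)) ^ Fintype.card J := by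
    simp only [dnfUnsat, ← Finset.prod_mul_distrib]
    rw [expect_pi_prod (fun _ τ => (1 - termSat τ x) * (1 - termSat τ y)), Finset.prod_const,
      Finset.card_univ]
  have hx := satProb_nonneg x
  have hx1 := satProb_le_one x
  have hy := satProb_nonneg y
  have hy1 := satProb_le_one y
  have h0 : ∀ τ : A → B, 0 ≤ termSat τ x * termSat τ y := fun τ =>
    mul_nonneg (termSat_nonneg τ x) (termSat_nonneg τ y)
  have h2 : (𝔼 τ : A → B, (1 - termSat τ x) * (1 - termSat τ y)) =
      1 - satProb x - satProb y + 𝔼 τ : A → B, termSat τ x * termSat τ y := by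
    have : ∀ τ : A → B, (1 - termSat τ x) * (1 - termSat τ y) =
        1 - termSat τ x - termSat τ y + termSat τ x * termSat τ y := fun τ => by ring
    simp only [this]
    rw [Finset.expect_add_distrib, Finset.expect_sub_distrib, Finset.expect_sub_distrib,
      Fintype.expect_const, satProb, satProb]
  have h3 : 0 ≤ 𝔼 τ : A → B, (1 - termSat τ x) * (1 - termSat τ y) :=
    Finset.expect_nonneg fun τ _ => mul_nonneg (sub_nonneg.2 (termSat_le_one τ x))
      (sub_nonneg.2 (termSat_le_one τ y))
  have h4 : 𝔼 τ : A → B, (1 - termSat τ x) * (1 - termSat τ y) ≤ 1 :=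
    Finset.expect_le Finset.univ_nonempty fun τ _ => mul_le_one₀
      (sub_le_self _ (termSat_nonneg τ x)) (sub_nonneg.2 (termSat_le_one τ y))
      (sub_le_self _ (termSat_nonneg τ y))
  have h5 : 0 ≤ 𝔼 τ : A → B, termSat τ x * termSat τ y := Finset.expect_nonneg fun τ _ => h0 τ
  rw [h1, ← mul_pow]
  refine (abs_pow_sub_pow_le_of_mem_Icc h3 h4
    (mul_nonneg (sub_nonneg.2 hx1) (sub_nonneg.2 hy1))
    (mul_le_one₀ (by linarith) (by linarith) (by linarith)) _).trans ?_
  gcongr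
  rw [h2, abs_le]
  have := mul_nonneg hx hy
  constructor <;> nlinarith

section RandomDNF

variable {A B : Type*} [Fintype A] [DecidableEq A] [Fintype B] [DecidableEq B]

lemma expect_termSat (τ : A → B) :
    𝔼 x : A → B → Bool, termSat τ x = (1 / 2) ^ Fintype.card A := by
  simp only [termSat]
  rw [expect_pi_prod (fun i (z : B → Bool) => bitVal (z (τ i)))]
  simp [expect_bitVal]

lemma expect_satProb [Nonempty B] :
    𝔼 x : A → B → Bool, satProb x = (1 / 2) ^ Fintype.card A := by
  simp only [satProb]
  rw [Finset.expect_comm]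
  simp only [expect_termSat]
  exact Fintype.expect_const _

lemma expect_satProb_sq [Nonempty B] : 𝔼 x : A → B → Bool, satProb x ^ 2 =
    (1 / 4) ^ Fintype.card A * (1 + 1 / Fintype.card B) ^ Fintype.card A := by
  have h : ∀ x : A → B → Bool, satProb x ^ 2 =
      ∏ i, (𝔼 b, 𝔼 c, bitVal (x i b) * bitVal (x i c)) := by
    intro x
    simp only [satProb, termSat]
    rw [expect_pi_prod (fun i b => bitVal (x i b)), ← Finset.prod_pow]
    simp only [sq, Fintype.expect_mul_expect]
  simp only [h]
  rw [expect_pi_prod (fun _ (z : B → Bool) => 𝔼 b, 𝔼 c, bitVal (z b) * bitVal (z c))]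
  have h2 : (𝔼 z : B → Bool, 𝔼 b, 𝔼 c, bitVal (z b) * bitVal (z c)) =
      1 / 4 * (1 + 1 / Fintype.card B) := by
    rw [Finset.expect_comm]
    have h3 : ∀ b : B, (𝔼 z : B → Bool, 𝔼 c, bitVal (z b) * bitVal (z c)) =
        1 / 4 * (1 + 1 / Fintype.card B) := by
      intro b
      rw [Finset.expect_comm]
      simp only [expect_bitVal_mul_bitVal]
      rw [Fintype.expect_eq_sum_div_card, Finset.sum_add_distrib, Finset.sum_ite_eq]
      have : (Fintype.card B : ℝ) ≠ 0 := by simp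
      simp
      field_simp
    simp only [h3]
    exact Fintype.expect_const _
  rw [h2, Finset.prod_const, mul_pow, Finset.card_univ]

variable {J : Type*} [Fintype J]

lemma expect_abs_covariance_dnfUnsat_le [DecidableEq J] [Nonempty B] :
    𝔼 x : A → B → Bool, 𝔼 y : A → B → Bool, |(𝔼 T : J → A → B, dnfUnsat T x * dnfUnsat T y) -
      (1 - satProb x) ^ Fintype.card J * (1 - satProb y) ^ Fintype.card J| ≤
      2 * Fintype.card J * (1 / 4) ^ Fintype.card A := by
  have h14 : ((1 / 2 : ℝ) ^ Fintype.card A) * (1 / 2) ^ Fintype.card A =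
      (1 / 4) ^ Fintype.card A := by
    rw [← mul_pow]; norm_num
  calc _ ≤ 𝔼 x : A → B → Bool, 𝔼 y : A → B → Bool, (Fintype.card J : ℝ) *
        ((𝔼 τ : A → B, termSat τ x * termSat τ y) + satProb x * satProb y) :=
        Finset.expect_le_expect fun x _ => Finset.expect_le_expect fun y _ =>
          abs_covariance_dnfUnsat_le x y
    _ = Fintype.card J * ((𝔼 x : A → B → Bool, 𝔼 y : A → B → Bool, 𝔼 τ : A → B,
          termSat τ x * termSat τ y) + 𝔼 x : A → B → Bool, 𝔼 y : A → B → Bool,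
            satProb x * satProb y) := by
        simp only [← Finset.mul_expect, Finset.expect_add_distrib]
    _ = Fintype.card J * ((1 / 4) ^ Fintype.card A + (1 / 4) ^ Fintype.card A) := by
        congr 2
        · have : ∀ x : A → B → Bool, (𝔼 y : A → B → Bool, 𝔼 τ : A → B,
              termSat τ x * termSat τ y) = 𝔼 τ : A → B, termSat τ x * (1 / 2) ^ Fintype.card A := by
            intro x
            rw [Finset.expect_comm]
            simp only [← Finset.mul_expect, expect_termSat]
          simp only [this]
          rw [Finset.expect_comm]
          simp only [← Finset.expect_mul, expect_termSat, h14]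
          exact Fintype.expect_const _
        · rw [← Fintype.expect_mul_expect, expect_satProb, h14]
    _ = _ := by ring

lemma expect_abs_bias_le [Nonempty B] :
    𝔼 x : A → B → Bool, |1 - 2 * (1 - satProb x) ^ Fintype.card J| ≤
      |1 - 2 * (1 - (1 / 2 : ℝ) ^ Fintype.card A) ^ Fintype.card J| +
      2 * Fintype.card J * (1 / 2) ^ Fintype.card A *
        √((1 + 1 / Fintype.card B) ^ Fintype.card A - 1) := by
  set t : ℝ := (1 / 2) ^ Fintype.card A with ht
  have ht0 : 0 ≤ t := by positivity
  have ht1 : t ≤ 1 := pow_le_one₀ (by norm_num) (by norm_num)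
  have hvar : 𝔼 x : A → B → Bool, (satProb x - t) ^ 2 =
      t ^ 2 * ((1 + 1 / Fintype.card B) ^ Fintype.card A - 1) := by
    have h : ∀ x : A → B → Bool, (satProb x - t) ^ 2 =
        satProb x ^ 2 - 2 * t * satProb x + t ^ 2 := fun x => by ring
    simp only [h]
    rw [Finset.expect_add_distrib, Finset.expect_sub_distrib, ← Finset.mul_expect,
      expect_satProb, expect_satProb_sq, Fintype.expect_const, ← ht]
    have h4 : (1 / 4 : ℝ) ^ Fintype.card A = t ^ 2 := by
      rw [ht, ← pow_mul, mul_comm, pow_mul]; norm_num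
    rw [h4]; ring
  have hdev : 𝔼 x : A → B → Bool, |satProb x - t| ≤
      t * √((1 + 1 / Fintype.card B) ^ Fintype.card A - 1) := by
    refine (expect_abs_le_sqrt _).trans ?_
    rw [hvar, Real.sqrt_mul (sq_nonneg t), Real.sqrt_sq ht0]
  have hpt : ∀ x : A → B → Bool, |1 - 2 * (1 - satProb x) ^ Fintype.card J| ≤
      |1 - 2 * (1 - t) ^ Fintype.card J| + 2 * Fintype.card J * |satProb x - t| := by
    intro x
    have h1 := abs_pow_sub_pow_le_of_mem_Icc (a := 1 - satProb x) (b := 1 - t)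
      (sub_nonneg.2 (satProb_le_one x)) (sub_le_self _ (satProb_nonneg x)) (sub_nonneg.2 ht1)
      (sub_le_self _ ht0) (Fintype.card J)
    have h2 : |1 - satProb x - (1 - t)| = |satProb x - t| := by
      rw [← abs_neg]; congr 1; ring
    rw [h2] at h1
    have h3 := abs_sub (1 - 2 * (1 - t) ^ Fintype.card J)
      (2 * ((1 - satProb x) ^ Fintype.card J - (1 - t) ^ Fintype.card J))
    rw [abs_mul, abs_two] at h3
    calc _ = |1 - 2 * (1 - t) ^ Fintype.card J -
          2 * ((1 - satProb x) ^ Fintype.card J - (1 - t) ^ Fintype.card J)| := by congr 1; ring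
      _ ≤ _ := by linarith
  calc _ ≤ 𝔼 x : A → B → Bool, (|1 - 2 * (1 - t) ^ Fintype.card J| +
        2 * Fintype.card J * |satProb x - t|) := Finset.expect_le_expect fun x _ => hpt x
    _ = |1 - 2 * (1 - t) ^ Fintype.card J| +
        2 * Fintype.card J * 𝔼 x : A → B → Bool, |satProb x - t| := by
        rw [Finset.expect_add_distrib, Fintype.expect_const, Finset.mul_expect]
    _ ≤ _ := by
        have := mul_le_mul_of_nonneg_left hdev
          (by positivity : (0 : ℝ) ≤ 2 * Fintype.card J)
        linarith

end RandomDNF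

lemma card_filter_card_le {ι : Type*} [Fintype ι] [DecidableEq ι] (d : ℕ) :
    #{S : Finset ι | #S ≤ d} ≤ (Fintype.card ι + 1) ^ d := by
  have hsub : ({S : Finset ι | #S ≤ d} : Finset (Finset ι)) ⊆
      (Finset.range (d + 1)).biUnion fun i => Finset.powersetCard i Finset.univ := by
    intro S hS
    simp only [Finset.mem_filter_univ] at hS
    simp only [Finset.mem_biUnion, Finset.mem_range, Finset.mem_powersetCard]
    exact ⟨#S, by omega, Finset.subset_univ S, rfl⟩
  refine (Finset.card_le_card hsub).trans (Finset.card_biUnion_le.trans ?_)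
  rw [add_pow]
  refine Finset.sum_le_sum fun i hi => ?_
  rw [Finset.card_powersetCard, Finset.card_univ, one_pow, mul_one]
  exact (Nat.choose_le_pow _ _).trans
    (Nat.le_mul_of_pos_right _ (Nat.choose_pos (by simpa [Nat.lt_succ_iff] using hi)))

lemma exists_abs_one_sub_two_mul_pow_le (w : ℕ) :
    ∃ m ≤ 2 ^ w, |1 - 2 * (1 - (1 / 2 : ℝ) ^ w) ^ m| ≤ (1 / 2) ^ w := by
  classical
  set t : ℝ := (1 / 2) ^ w with ht
  have ht0 : 0 < t := by positivity
  have ht1 : t ≤ 1 := pow_le_one₀ (by norm_num) (by norm_num)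
  have hP : (1 - t) ^ (2 ^ w) ≤ 1 / 2 := by
    have h1 := one_add_mul_le_pow (a := t) (by linarith) (2 ^ w)
    have h2 : ((2 ^ w : ℕ) : ℝ) * t = 1 := by
      rw [ht]; push_cast; rw [← mul_pow]; norm_num
    rw [h2] at h1
    have h3 : (1 - t) ^ (2 ^ w) * (1 + t) ^ (2 ^ w) ≤ 1 := by
      rw [← mul_pow]
      exact pow_le_one₀ (mul_nonneg (by linarith) (by linarith)) (by nlinarith)
    nlinarith [pow_nonneg (sub_nonneg.2 ht1) (2 ^ w)]
  have hex : ∃ m : ℕ, (1 - t) ^ m ≤ 1 / 2 := ⟨_, hP⟩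
  refine ⟨Nat.find hex, Nat.find_min' hex hP, ?_⟩
  have hle := Nat.find_spec hex
  have hlt : ∀ n < Nat.find hex, 1 / 2 < (1 - t) ^ n := fun n hn =>
    not_le.1 (Nat.find_min hex hn)
  rcases hm : Nat.find hex with _ | n
  · rw [hm] at hle; norm_num at hle
  · rw [hm] at hle hlt
    have h := hlt n n.lt_succ_self
    rw [pow_succ] at hle ⊢
    rw [abs_le]
    constructor <;> nlinarith

/-- A random monotone DNF on `w` blocks of `L` variables yields a monotone approximately resilient
function. -/
lemma exists_monotone_approxResilient (w L m d : ℕ) [NeZero L] {δ : ℝ} (hδ : 0 ≤ δ)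
    (h : 8 * ((w * L + 1 : ℕ) ^ d : ℝ) ^ 2 * m * (1 / 4) ^ w ≤ δ ^ 2) :
    ∃ F : (Fin (w * L) → Bool) → ℝ, IsBooleanValued F ∧ Monotone F ∧
      ApproxResilient (2 * (|1 - 2 * (1 - (1 / 2 : ℝ) ^ w) ^ m| +
        2 * m * (1 / 2) ^ w * √((1 + 1 / L) ^ w - 1)) + 2 * δ) d F := by
  let E : (Fin (w * L) → Bool) ≃ (Fin w → Fin L → Bool) :=
    (Equiv.arrowCongr finProdFinEquiv.symm (Equiv.refl Bool)).trans
      (Equiv.curry (Fin w) (Fin L) Bool)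
  have hE : Monotone E := fun x y hxy i j => hxy (finProdFinEquiv (i, j))
  have hbias := expect_abs_bias_le (A := Fin w) (B := Fin L) (J := Fin m)
  have hcov := expect_abs_covariance_dnfUnsat_le (A := Fin w) (B := Fin L) (J := Fin m)
  simp only [Fintype.card_fin] at hbias hcov
  let Ψ : (Fin w → Fin L → Bool) → (Fin w → Fin L → Bool) → ℝ := fun x y =>
    |(𝔼 T : Fin m → Fin w → Fin L, dnfUnsat T x * dnfUnsat T y) -
      (1 - satProb x) ^ m * (1 - satProb y) ^ m|
  have hΨ : (𝔼 x, 𝔼 y, Ψ (E x) (E y)) = 𝔼 x, 𝔼 y, Ψ x y :=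
    Fintype.expect_equiv E _ (fun x => 𝔼 y, Ψ x y) fun x =>
      Fintype.expect_equiv E _ (Ψ (E x)) fun _ => rfl
  obtain ⟨T, hT⟩ := exists_approxResilient_of_covariance d ((w * L + 1) ^ d)
    (fun (T : Fin m → Fin w → Fin L) x => dnfUnsat T (E x))
    (fun T x => dnfUnsat_eq_zero_or_one T (E x))
    (fun x => (1 - satProb (E x)) ^ m)
    (fun x => by rw [expect_dnfUnsat, Fintype.card_fin])
    ((Fintype.expect_equiv E _ _ fun x => rfl).trans_le hbias)
    (hΨ.trans_le hcov)
    ((card_filter_card_le d).trans_eq (by rw [Fintype.card_fin])) hδ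
    (le_trans (le_of_eq (by push_cast; ring)) h)
  refine ⟨_, ?_, ?_, hT⟩
  · intro x
    rcases dnfUnsat_eq_zero_or_one T (E x) with h | h
    · left; simp [h]
    · right; norm_num [h]
  · intro x y hxy
    have := dnfUnsat_antitone T (hE hxy)
    simp only
    linarith

lemma sqrt_one_add_inv_sq_pow_sub_one_le {w : ℕ} (hw : 1 ≤ w) :
    √((1 + 1 / (w ^ 2 : ℕ) : ℝ) ^ w - 1) ≤ 2 / √w := by
  have hw0 : (1 : ℝ) ≤ w := by exact_mod_cast hw
  have h1 : (1 + 1 / (w ^ 2 : ℕ) : ℝ) ^ w ≤ 1 + 2 / w := by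
    have h2 : (1 + 1 / (w ^ 2 : ℕ) : ℝ) ^ w ≤ Real.exp (1 / w) := by
      have h3 : (1 / w : ℝ) = w * (1 / (w ^ 2 : ℕ)) := by
        push_cast; field_simp
      rw [h3, Real.exp_nat_mul]
      gcongr
      rw [add_comm]
      exact Real.add_one_le_exp _
    have h4 : |(1 / w : ℝ)| ≤ 1 := by
      rw [abs_of_nonneg (by positivity), div_le_one (by linarith)]
      exact hw0
    have h5 := (le_abs_self _).trans (Real.abs_exp_sub_one_le h4)
    rw [abs_of_nonneg (by positivity : (0 : ℝ) ≤ 1 / w)] at h5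
    have : (2 : ℝ) / w = 2 * (1 / w) := by ring
    linarith
  rw [Real.sqrt_le_left (by positivity), div_pow, Real.sq_sqrt (by linarith)]
  have : (0 : ℝ) < 1 / w := by positivity
  have e2 : (2 : ℝ) / w = 2 * (1 / w) := by ring
  have e4 : (2 : ℝ) ^ 2 / w = 4 * (1 / w) := by ring
  linarith

lemma mul_le_two_pow_three_mul {k : ℕ} (hk : 3 ≤ k) : 52 * k ≤ 2 ^ (3 * k) := by
  induction k, hk using Nat.le_induction with
  | base => norm_num
  | succ n hn ih =>
    have : 2 ^ (3 * (n + 1)) = 8 * 2 ^ (3 * n) := by ring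
    omega

/-- With blocks `w = 2 ^ (4 * k)`, `L = 2 ^ (8 * k)` and degree `2 ^ k`, the distance to resilience
is `O(2 ^ (-2 * k))`. -/
lemma exists_monotone_approxResilient_two_pow {k : ℕ} (hk : 3 ≤ k) :
    ∃ F : (Fin (2 ^ (4 * k) * 2 ^ (8 * k)) → Bool) → ℝ, IsBooleanValued F ∧ Monotone F ∧
      ApproxResilient (18 / 2 ^ (2 * k)) (2 ^ k) F := by
  set w : ℕ := 2 ^ (4 * k) with hw
  have hL : 2 ^ (8 * k) = w ^ 2 := by rw [hw, ← pow_mul]; congr 1; ring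
  have hw1 : 1 ≤ w := Nat.one_le_two_pow
  have hwr : (1 : ℝ) ≤ w := by exact_mod_cast hw1
  set s : ℝ := 2 ^ (2 * k) with hs
  have hs1 : 1 ≤ s := one_le_pow₀ (by norm_num)
  have hws : (w : ℝ) = s ^ 2 := by rw [hw, hs]; push_cast; rw [← pow_mul]; congr 1; ring
  have hsq : √(w : ℝ) = s := by rw [hws, Real.sqrt_sq (by linarith)]
  rw [hL]
  have : NeZero (w ^ 2) := ⟨by positivity⟩
  obtain ⟨m, hm, hmb⟩ := exists_abs_one_sub_two_mul_pow_le w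
  have hm' : (m : ℝ) * (1 / 2) ^ w ≤ 1 := by
    have : (m : ℝ) ≤ 2 ^ w := by exact_mod_cast hm
    calc (m : ℝ) * (1 / 2) ^ w ≤ 2 ^ w * (1 / 2) ^ w := by gcongr
      _ = 1 := by rw [← mul_pow]; norm_num
  have hhalf : (1 / 2 : ℝ) ^ w ≤ 1 / s := by
    have h1 : (w : ℝ) ≤ 2 ^ w := by exact_mod_cast (Nat.lt_two_pow_self (n := w)).le
    rw [div_pow, one_pow]
    exact one_div_le_one_div_of_le (by linarith) (by nlinarith)
  have hcount : ((w * w ^ 2 + 1 : ℕ) ^ (2 ^ k) : ℝ) ^ 2 * s ^ 2 ≤ 2 * 2 ^ w := by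
    obtain ⟨v, hv⟩ : ∃ v, w = 2 * v := ⟨2 ^ (4 * k - 1), by
      rw [hw, ← pow_succ']; congr 1; omega⟩
    have h1 : (w * w ^ 2 + 1) ≤ 2 ^ (13 * k) := by
      have e1 : w * w ^ 2 = 2 ^ (12 * k) := by
        rw [hw, ← pow_mul, ← pow_add]; congr 1; ring
      have e2 : 2 ^ (12 * k + 1) ≤ 2 ^ (13 * k) := Nat.pow_le_pow_right (by norm_num) (by omega)
      have e3 : 1 ≤ 2 ^ (12 * k) := Nat.one_le_two_pow
      rw [pow_succ] at e2
      omega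
    have h2 : ((w * w ^ 2 + 1) ^ (2 ^ k)) ^ 2 ≤ 2 ^ v := by
      calc ((w * w ^ 2 + 1) ^ (2 ^ k)) ^ 2 ≤ ((2 ^ (13 * k)) ^ (2 ^ k)) ^ 2 := by gcongr
        _ = 2 ^ (26 * k * 2 ^ k) := by rw [← pow_mul, ← pow_mul]; congr 1; ring
        _ ≤ 2 ^ v := by
          refine Nat.pow_le_pow_right (by norm_num) ?_
          have h3 := Nat.mul_le_mul_right (2 ^ k) (mul_le_two_pow_three_mul hk)
          have h4 : 2 ^ (3 * k) * 2 ^ k = w := by rw [hw, ← pow_add]; congr 1; ring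
          rw [h4] at h3
          have h5 : 52 * k * 2 ^ k = 2 * (26 * k * 2 ^ k) := by ring
          omega
    have h3 : w ≤ 2 * 2 ^ v := by
      have := (Nat.lt_two_pow_self (n := v)).le
      omega
    have h4 : ((w * w ^ 2 + 1) ^ (2 ^ k)) ^ 2 * w ≤ 2 * 2 ^ w := by
      calc _ ≤ 2 ^ v * (2 * 2 ^ v) := Nat.mul_le_mul h2 h3
        _ = 2 * 2 ^ (2 * v) := by rw [two_mul v, pow_add]; ring
        _ = _ := by rw [← hv]
    rw [← hws]
    exact_mod_cast h4
  obtain ⟨F, hF1, hF2, hF3⟩ := exists_monotone_approxResilient w (w ^ 2) m (2 ^ k)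
    (δ := 4 / s) (by positivity) (by
      rw [div_pow 4 s, le_div_iff₀ (by positivity)]
      have e : (1 / 4 : ℝ) ^ w = (1 / 2) ^ w * (1 / 2) ^ w := by rw [← mul_pow]; norm_num
      have e2 : (2 : ℝ) ^ w * (1 / 2) ^ w = 1 := by rw [← mul_pow]; norm_num
      calc _ = 8 * (((w * w ^ 2 + 1 : ℕ) ^ (2 ^ k) : ℝ) ^ 2 * s ^ 2) * (m * (1 / 2) ^ w) *
            (1 / 2) ^ w := by rw [e]; ring
        _ ≤ 8 * (2 * 2 ^ w) * 1 * (1 / 2) ^ w := by gcongr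
        _ = 16 * (2 ^ w * (1 / 2) ^ w) := by ring
        _ ≤ 4 ^ 2 := by rw [e2]; norm_num)
  refine ⟨F, hF1, hF2, ?_⟩
  obtain ⟨g, hg1, hg2, hg3⟩ := hF3
  refine ⟨g, hg1, hg2, hg3.trans ?_⟩
  have hsqrt := sqrt_one_add_inv_sq_pow_sub_one_le hw1
  rw [hsq] at hsqrt
  have hprod : 2 * (m : ℝ) * (1 / 2) ^ w * √((1 + 1 / (w ^ 2 : ℕ)) ^ w - 1) ≤ 2 * (2 / s) := by
    calc _ = 2 * ((m * (1 / 2) ^ w) * √((1 + 1 / (w ^ 2 : ℕ)) ^ w - 1)) := by ring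
      _ ≤ 2 * (1 * (2 / s)) := by gcongr
      _ = _ := by ring
  have e18 : 18 / s = 2 * (1 / s + 2 * (2 / s)) + 2 * (4 / s) := by ring
  rw [e18]
  linarith

/-- **Explicit monotone functions with high approximate resilience (iterated Tribes).** There is
a universal `c > 0` such that for every `ε > 0` there are arbitrarily large `N` admitting a
monotone Boolean `F : {-1,1}^N → {-1,1}` that is `ε`-approximately `d`-resilient for some
`d ≥ 2^{c·√(log N)}`. -/
theorem stmt13 :
    ∃ c : ℝ, 0 < c ∧
      ∀ ε : ℝ, 0 < ε → ∀ M : ℕ, ∃ N : ℕ, M ≤ N ∧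
        ∃ F : (Fin N → Bool) → ℝ, IsBooleanValued F ∧ Monotone F ∧
          ∃ d : ℕ, (2 : ℝ) ^ (c * Real.sqrt (Real.log N)) ≤ (d : ℝ) ∧
            ApproxResilient ε d F := by
  refine ⟨1 / 4, by norm_num, fun ε hε M => ?_⟩
  obtain ⟨n, hn⟩ := exists_nat_ge (18 / ε)
  set k := max 3 (max M n) with hk
  have hk3 : 3 ≤ k := le_max_left _ _
  have hMk : M ≤ k := (le_max_left _ _).trans (le_max_right _ _)
  have hnk : n ≤ k := (le_max_right _ _).trans (le_max_right _ _)
  obtain ⟨F, hF1, hF2, g, hg1, hg2, hg3⟩ := exists_monotone_approxResilient_two_pow hk3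
  have hN : 2 ^ (4 * k) * 2 ^ (8 * k) = 2 ^ (12 * k) := by rw [← pow_add]; congr 1; ring
  refine ⟨_, ?_, F, hF1, hF2, 2 ^ k, ?_, g, hg1, hg2, hg3.trans ?_⟩
  · rw [hN]
    have := (Nat.lt_two_pow_self (n := 12 * k)).le
    omega
  · rw [hN]
    push_cast
    rw [Real.log_pow, ← Real.rpow_natCast 2 k]
    refine Real.rpow_le_rpow_of_exponent_le (by norm_num) ?_
    have hkr : (3 : ℝ) ≤ k := by exact_mod_cast hk3
    have h1 : √(((12 * k : ℕ) : ℝ) * Real.log 2) ≤ 4 * k := by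
      rw [Real.sqrt_le_left (by positivity)]
      have := Real.log_two_lt_d9
      push_cast
      nlinarith
    linarith
  · rw [div_le_iff₀ (by positivity)]
    rw [div_le_iff₀ hε] at hn
    have h1 : (n : ℝ) ≤ 2 ^ (2 * k) := by
      have := (Nat.lt_two_pow_self (n := 2 * k)).le
      exact_mod_cast (show n ≤ 2 ^ (2 * k) by omega)
    nlinarith
end
end
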